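/- arXiv:2004.12558 — 2 statements merged into one kernel-verified Lean document; each statement's English description precedes it below -/
import Mathlib

section
/- For every σ > 0 there exists ε_0 > 0 such that for all ε, ρ with 0 < ε ≤ ε_0 and 0 < ρ ≤ ε/4 there exists N such that for every n ∈ 3ℤ with n ≥ N the following holds: let H be a (1,3)-partite 4-graph with partition classes Q, P, 3|Q| = |P| = n, such that H is not ε-close to any H_{1,3}(n, n/3) on V(H) (with larger class P and smaller class Q), and d_H({u, v}) ≥ C(n−1, 2) − C(2n/3, 2) − ρn² for all v ∈ Q and u ∈ P. Then H contains a matching covering all but at most σn vertices. -/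
/-- The extremal (1,3)-partite 4-graph `H_{1,3}(n, n/3)`: assuming `Q, P` partition the
vertex set and `W ⊆ P`, its edges are exactly the sets `s` with `|s ∩ Q| = 1`,
`|s ∩ P| = 3`, `(s ∩ P) ∩ W ≠ ∅` and `¬ s ∩ P ⊆ W`. -/
def extremalH13 {V : Type*} [Fintype V] [DecidableEq V] (Q P W : Finset V) :
    Finset (Finset V) :=
  Finset.univ.filter (fun e =>
    (e ∩ Q).card = 1 ∧ (e ∩ P).card = 3 ∧ (e ∩ P ∩ W).Nonempty ∧ ¬ e ∩ P ⊆ W)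

section Helpers

open Finset


lemma apm_avg_step {α : Type*} [DecidableEq α] (F : α → α → ℝ) (hF : ∀ a, F a a = 0)
    (S : Finset α) (hS : S.Nonempty) :
    ∃ i ∈ S, ((S.card : ℝ) - 2) * (∑ a ∈ S, ∑ b ∈ S, F a b) ≤
      S.card * ∑ a ∈ S.erase i, ∑ b ∈ S.erase i, F a b := by
  have key : ∀ i ∈ S, ∑ a ∈ S.erase i, ∑ b ∈ S.erase i, F a b =
      (∑ a ∈ S, ∑ b ∈ S, F a b) - (∑ b ∈ S, F i b) - (∑ a ∈ S, F a i) := by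
    intro i hi
    have h1 : ∀ a, ∑ b ∈ S.erase i, F a b = (∑ b ∈ S, F a b) - F a i := by
      intro a
      rw [← Finset.add_sum_erase S _ hi]; ring
    simp only [h1, Finset.sum_sub_distrib]
    rw [← Finset.add_sum_erase S (fun a => ∑ b ∈ S, F a b) hi,
      ← Finset.add_sum_erase S (fun a => F a i) hi, hF i]
    ring
  by_contra hcon
  push Not at hcon
  have h2 := Finset.sum_lt_sum_of_nonempty hS hcon
  rw [← Finset.mul_sum, Finset.sum_congr rfl key] at h2
  simp only [Finset.sum_sub_distrib, Finset.sum_const, nsmul_eq_mul] at h2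
  rw [Finset.sum_comm (f := fun x a => F a x)] at h2
  linarith

lemma apm_avg {α : Type*} [DecidableEq α] (F : α → α → ℝ) (hF : ∀ a, F a a = 0)
    (t : ℕ) (ht : 2 ≤ t) : ∀ (d : ℕ) (S : Finset α), S.card = t + d →
    ∃ T ⊆ S, T.card = t ∧
      (t : ℝ) * (t - 1) * (∑ a ∈ S, ∑ b ∈ S, F a b) ≤
        (S.card : ℝ) * (S.card - 1) * ∑ a ∈ T, ∑ b ∈ T, F a b := by
  intro d
  induction d with
  | zero =>
    intro S hS
    refine ⟨S, subset_rfl, by omega, ?_⟩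
    rw [hS]; simp
  | succ d ih =>
    intro S hS
    obtain ⟨i, hi, h⟩ := apm_avg_step F hF S (by rw [← Finset.card_pos]; omega)
    have hc : (S.erase i).card = t + d := by rw [Finset.card_erase_of_mem hi]; omega
    obtain ⟨T, hT, hTc, h'⟩ := ih _ hc
    refine ⟨T, hT.trans (Finset.erase_subset _ _), hTc, ?_⟩
    rw [hc] at h'
    rw [hS] at h ⊢
    push_cast at *
    set x := ∑ a ∈ S, ∑ b ∈ S, F a b
    set y := ∑ a ∈ S.erase i, ∑ b ∈ S.erase i, F a b
    set z := ∑ a ∈ T, ∑ b ∈ T, F a b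
    have ht' : (2 : ℝ) ≤ t := by exact_mod_cast ht
    have hd : (0 : ℝ) ≤ d := by positivity
    have hpos : (0 : ℝ) < (t : ℝ) + d - 1 := by linarith
    have e1 := mul_le_mul_of_nonneg_left h (show (0:ℝ) ≤ (t : ℝ) * (t - 1) by nlinarith)
    have e2 := mul_le_mul_of_nonneg_left h' (show (0:ℝ) ≤ (t : ℝ) + (d + 1) by linarith)
    have e3 : ((t : ℝ) + d - 1) * (t * (t - 1) * x) ≤
        ((t : ℝ) + d - 1) * ((t + (d + 1)) * (t + (d + 1) - 1) * z) := by nlinarith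
    exact le_of_mul_le_mul_left e3 hpos

lemma apm_bip {α β : Type*} [DecidableEq α] [DecidableEq β] (A : Finset α) (C : Finset β)
    (B : Finset (α × β)) (hB : B ⊆ A ×ˢ C) (r : ℕ) (h : r * (A.card + C.card) < B.card) :
    ∃ M ⊆ B, M.card = r + 1 ∧ ∀ p ∈ M, ∀ q ∈ M, p ≠ q → p.1 ≠ q.1 ∧ p.2 ≠ q.2 := by
  suffices H : ∀ k ≤ r + 1, ∃ M ⊆ B, M.card = k ∧
      ∀ p ∈ M, ∀ q ∈ M, p ≠ q → p.1 ≠ q.1 ∧ p.2 ≠ q.2 from H _ le_rfl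
  intro k
  induction k with
  | zero => exact fun _ => ⟨∅, by simp, by simp, by simp⟩
  | succ k ih =>
    intro hk
    obtain ⟨M, hMB, hMc, hM⟩ := ih (by omega)
    have : ∃ b ∈ B, b ∉ M.biUnion (fun p => ({p.1} ×ˢ C) ∪ (A ×ˢ {p.2})) := by
      by_contra hcon
      push Not at hcon
      have h1 := Finset.card_le_card (show B ⊆ _ from hcon)
      have h2 := Finset.card_biUnion_le_card_mul M
        (fun p => ({p.1} ×ˢ C) ∪ (A ×ˢ {p.2})) (A.card + C.card) (by
          intro p _
          refine (Finset.card_union_le _ _).trans ?_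
          simp; omega)
      have : M.card * (A.card + C.card) ≤ r * (A.card + C.card) :=
        Nat.mul_le_mul_right _ (by omega)
      omega
    obtain ⟨b, hb, hbn⟩ := this
    have hbAC := Finset.mem_product.1 (hB hb)
    have hb' : ∀ p ∈ M, b.1 ≠ p.1 ∧ b.2 ≠ p.2 := by
      intro p hp
      constructor <;> intro h <;> apply hbn <;>
        simp only [mem_biUnion, mem_union, mem_product, mem_singleton]
      · exact ⟨p, hp, Or.inl ⟨h, hbAC.2⟩⟩
      · exact ⟨p, hp, Or.inr ⟨hbAC.1, h⟩⟩
    refine ⟨insert b M, Finset.insert_subset hb hMB, ?_, ?_⟩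
    · rw [Finset.card_insert_of_notMem, hMc]
      intro h; exact (hb' b h).1 rfl
    · intro p hp q hq hpq
      rw [mem_insert] at hp hq
      rcases hp with rfl | hp <;> rcases hq with rfl | hq
      · exact absurd rfl hpq
      · exact hb' q hq
      · exact ⟨(hb' p hp).1.symm, (hb' p hp).2.symm⟩
      · exact hM p hp q hq hpq
lemma apm_triples {V : Type*} [DecidableEq V] : ∀ (k : ℕ) (S : Finset V), S.card = 3 * k →
    ∃ G : Finset (Finset V), G.card = k ∧ (∀ A ∈ G, A ⊆ S ∧ A.card = 3) ∧
      (∀ A ∈ G, ∀ B ∈ G, A ≠ B → Disjoint A B) ∧ G.biUnion id = S := by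
  intro k
  induction k with
  | zero => 
    intro S hS
    refine ⟨∅, by simp, by simp, by simp, ?_⟩
    simp at hS; simp [hS]
  | succ k ih =>
    intro S hS
    obtain ⟨A, hAS, hA⟩ := Finset.exists_subset_card_eq (s := S) (n := 3) (by omega)
    obtain ⟨G, hG, h1, h2, h3⟩ := ih (S \ A) (by rw [Finset.card_sdiff_of_subset hAS]; omega)
    have hdis : ∀ B ∈ G, Disjoint A B := fun B hB =>
      Finset.disjoint_of_subset_right (h1 B hB).1 Finset.disjoint_sdiff
    have hn : A ∉ G := by
      intro h
      have := hdis A h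
      simp at this
      simp [this] at hA
    refine ⟨insert A G, by rw [Finset.card_insert_of_notMem hn, hG], ?_, ?_, ?_⟩
    · intro B hB
      rw [mem_insert] at hB
      rcases hB with rfl | hB
      · exact ⟨hAS, hA⟩
      · exact ⟨(h1 B hB).1.trans sdiff_subset, (h1 B hB).2⟩
    · intro B hB C hC hBC
      rw [mem_insert] at hB hC
      rcases hB with rfl | hB <;> rcases hC with rfl | hC
      · exact absurd rfl hBC
      · exact hdis C hC
      · exact (hdis B hB).symm
      · exact h2 B hB C hC hBC
    · rw [Finset.biUnion_insert, h3]; simp [hAS]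

def ApmM {V : Type*} (R : V → V → Prop) (M : Finset (V × V)) : Prop :=
  (∀ p ∈ M, R p.1 p.2) ∧
  ∀ p ∈ M, ∀ q ∈ M, p ≠ q → p.1 ≠ q.1 ∧ p.1 ≠ q.2 ∧ p.2 ≠ q.1 ∧ p.2 ≠ q.2

def apmCov {V : Type*} [DecidableEq V] (M : Finset (V × V)) : Finset V :=
  M.biUnion (fun p => {p.1, p.2})

lemma mem_apmCov {V : Type*} [DecidableEq V] (M : Finset (V × V)) (x : V) :
    x ∈ apmCov M ↔ ∃ y, (x, y) ∈ M ∨ (y, x) ∈ M := by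
  simp only [apmCov, mem_biUnion, mem_insert, mem_singleton, Prod.exists]
  constructor
  · rintro ⟨a, b, h, rfl | rfl⟩
    · exact ⟨b, Or.inl h⟩
    · exact ⟨a, Or.inr h⟩
  · rintro ⟨y, h | h⟩
    · exact ⟨x, y, h, Or.inl rfl⟩
    · exact ⟨y, x, h, Or.inr rfl⟩

lemma apmM_insert {V : Type*} [DecidableEq V] {R : V → V → Prop} {M : Finset (V × V)}
    (hM : ApmM R M) {a b : V} (ha : a ∉ apmCov M) (hb : b ∉ apmCov M)
    (hR : R a b) : ApmM R (insert (a, b) M) ∧ (insert (a, b) M).card = M.card + 1 ∧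
      ∀ x, x ∈ apmCov (insert (a, b) M) ↔ x = a ∨ x = b ∨ x ∈ apmCov M := by
  rw [mem_apmCov] at ha hb
  push Not at ha hb
  refine ⟨⟨?_, ?_⟩, ?_, ?_⟩
  · intro p hp
    rw [mem_insert] at hp
    rcases hp with rfl | hp
    · exact hR
    · exact hM.1 p hp
  · have h2 := hM.2
    rintro ⟨p1, p2⟩ hp ⟨q1, q2⟩ hq hpq
    have := h2 (p1, p2)
    grind
  · rw [card_insert_of_notMem]; exact (ha b).1
  · intro x
    simp only [apmCov, biUnion_insert, mem_union, mem_insert, mem_singleton, or_assoc]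

lemma apmM_erase {V : Type*} [DecidableEq V] {R : V → V → Prop} {M : Finset (V × V)}
    (hM : ApmM R M) {x y : V} (h : (x, y) ∈ M ∨ (y, x) ∈ M) :
    ∃ M', M' ⊆ M ∧ ApmM R M' ∧ M'.card + 1 = M.card ∧
      ∀ z, z ∈ apmCov M' ↔ z ∈ apmCov M ∧ z ≠ x ∧ z ≠ y := by
  have main : ∀ p ∈ M, ∃ M', M' ⊆ M ∧ ApmM R M' ∧ M'.card + 1 = M.card ∧
      ∀ z, z ∈ apmCov M' ↔ z ∈ apmCov M ∧ z ≠ p.1 ∧ z ≠ p.2 := by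
    rintro ⟨a, b⟩ hp
    refine ⟨M.erase (a, b), erase_subset _ _, ⟨fun q hq => hM.1 q (mem_of_mem_erase hq),
      fun q hq q' hq' => hM.2 q (mem_of_mem_erase hq) q' (mem_of_mem_erase hq')⟩,
      card_erase_add_one hp, ?_⟩
    intro z
    simp only [mem_apmCov, mem_erase]
    have h2 := hM.2 (a, b) hp
    constructor
    · rintro ⟨w, ⟨h1, h3⟩ | ⟨h1, h3⟩⟩
      · have := h2 _ h3 (Ne.symm h1)
        refine ⟨⟨w, Or.inl h3⟩, Ne.symm this.1, Ne.symm this.2.2.1⟩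
      · have := h2 _ h3 (Ne.symm h1)
        refine ⟨⟨w, Or.inr h3⟩, Ne.symm this.2.1, Ne.symm this.2.2.2⟩
    · rintro ⟨⟨w, h3 | h3⟩, h4, h5⟩
      · exact ⟨w, Or.inl ⟨fun h => h4 (congrArg Prod.fst h), h3⟩⟩
      · exact ⟨w, Or.inr ⟨fun h => h5 (congrArg Prod.snd h), h3⟩⟩
  rcases h with h | h
  · exact main _ h
  · obtain ⟨M', h1, h2, h3, h4⟩ := main _ h
    exact ⟨M', h1, h2, h3, fun z => by rw [h4 z]; tauto⟩

lemma apm_arith (t s r a i : ℕ) (hi : i + 2 * s = 3 * t) (ha : a ≤ s) (hs : s ≤ r) (hr : r ≤ t) :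
    2 * (a * i + (2 * s - 2 * a)) + ((2 * s) * (2 * s) - a * a) ≤ t ^ 2 + 4 * t * r + 4 * t := by
  obtain ⟨b, rfl⟩ := Nat.exists_eq_add_of_le ha
  obtain ⟨c, rfl⟩ := Nat.exists_eq_add_of_le hs
  obtain ⟨d, rfl⟩ := Nat.exists_eq_add_of_le hr
  have : i = a + b + 3 * c + 3 * d := by omega
  subst this
  have e1 : 2 * (a + b) - 2 * a = 2 * b := by omega
  have e2 : 2 * (a + b) * (2 * (a + b)) - a * a = 3 * a * a + 8 * a * b + 4 * b * b := by
    rw [Nat.sub_eq_iff_eq_add (by nlinarith)]; ring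
  rw [e1, e2]
  nlinarith [Nat.zero_le (a*b), Nat.zero_le (a*c), Nat.zero_le (a*d), Nat.zero_le (b*c), Nat.zero_le (b*d), Nat.zero_le (c*d), Nat.zero_le (a*a), Nat.zero_le (b*b), Nat.zero_le (c*c), Nat.zero_le (d*d)]

open Classical in
lemma apm_EG {V : Type*} (R : V → V → Prop) (hsym : ∀ x y, R x y → R y x)
    (hirr : ∀ x, ¬ R x x) (X : Finset V) (t r : ℕ) (hX : X.card = 3 * t) (hr : r ≤ t)
    (hE : t ^ 2 + 4 * t * r + 4 * t < ((X ×ˢ X).filter (fun p => R p.1 p.2)).card) :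
    ∃ M ⊆ X ×ˢ X, M.card = r + 1 ∧ ApmM R M := by
  by_contra hcon
  push Not at hcon
  obtain ⟨M, hMmem, hMmax⟩ := Finset.exists_max_image
    ((X ×ˢ X).powerset.filter (fun M => ApmM R M)) Finset.card
    ⟨∅, by simp [ApmM]⟩
  rw [mem_filter, mem_powerset] at hMmem
  obtain ⟨hMX, hM⟩ := hMmem
  have hmax : ∀ M' ⊆ X ×ˢ X, ApmM R M' → M'.card ≤ M.card := fun M' h1 h2 =>
    hMmax M' (by rw [mem_filter, mem_powerset]; exact ⟨h1, h2⟩)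
  have hs : M.card ≤ r := by
    by_contra h
    obtain ⟨M', h1, h2⟩ := Finset.exists_subset_card_eq (s := M) (n := r + 1) (by omega)
    exact hcon M' (h1.trans hMX) h2 ⟨fun p hp => hM.1 p (h1 hp),
      fun p hp q hq => hM.2 p (h1 hp) q (h1 hq)⟩
  set C := apmCov M with hC
  have hCX : C ⊆ X := by
    intro x hx
    rw [hC, mem_apmCov] at hx
    obtain ⟨y, h | h⟩ := hx
    · exact (mem_product.1 (hMX h)).1
    · exact (mem_product.1 (hMX h)).2
  have hCcard : C.card = 2 * M.card := by
    rw [hC, apmCov, card_biUnion, Finset.sum_const_nat (m := 2), mul_comm]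
    · intro p hp
      refine card_pair ?_
      intro h
      have := hM.1 p hp
      rw [h] at this
      exact hirr _ this
    · intro p hp q hq hpq
      have := hM.2 p hp q hq hpq
      simp only [disjoint_left, mem_insert, mem_singleton]
      rintro x (rfl | rfl) <;> push Not <;> tauto
  -- augmentation facts
  have ext1 : ∀ M' ⊆ X ×ˢ X, ApmM R M' → ∀ a ∈ X, ∀ b ∈ X, a ∉ apmCov M' → b ∉ apmCov M' →
      R a b → ∃ M'' ⊆ X ×ˢ X, ApmM R M'' ∧ M''.card = M'.card + 1 ∧
        ∀ x, x ∈ apmCov M'' ↔ x = a ∨ x = b ∨ x ∈ apmCov M' := by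
    intro M' h1 h2 a ha b hb ha' hb' hab
    obtain ⟨h3, h4, h5⟩ := apmM_insert h2 ha' hb' hab
    exact ⟨_, insert_subset (mem_product.2 ⟨ha, hb⟩) h1, h3, h4, h5⟩
  set I := X \ C with hI
  have hIX : ∀ z ∈ I, z ∈ X := fun z hz => (mem_sdiff.1 hz).1
  have hIC : ∀ z ∈ I, z ∉ C := fun z hz => (mem_sdiff.1 hz).2
  have hIcard : I.card + 2 * M.card = 3 * t := by
    rw [hI, card_sdiff_of_subset hCX, hCcard, hX]
    have := card_le_card hCX
    omega
  have f0 : ∀ a ∈ I, ∀ b ∈ I, ¬ R a b := by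
    intro a ha b hb hab
    obtain ⟨M2, h1, h2, h3, -⟩ := ext1 M hMX hM a (hIX a ha) b (hIX b hb)
      (hIC a ha) (hIC b hb) hab
    have := hmax M2 h1 h2
    omega
  have hmate : ∀ x ∈ C, ∃ y, (x, y) ∈ M ∨ (y, x) ∈ M := fun x hx => by
    rwa [hC, mem_apmCov] at hx
  have hmateC : ∀ x y, ((x, y) ∈ M ∨ (y, x) ∈ M) → x ∈ C ∧ y ∈ C ∧ R x y := by
    intro x y h
    refine ⟨?_, ?_, ?_⟩
    · rw [hC, mem_apmCov]; exact ⟨y, h⟩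
    · rw [hC, mem_apmCov]; exact ⟨x, h.symm⟩
    · rcases h with h | h
      · exact hM.1 _ h
      · exact hsym _ _ (hM.1 _ h)
  have f1 : ∀ x y, ((x, y) ∈ M ∨ (y, x) ∈ M) → ∀ z ∈ I, ∀ z' ∈ I, z ≠ z' → R x z' →
      ¬ R y z := by
    intro x y hxy z hz z' hz' hne hxz hyz
    obtain ⟨hxC, hyC, hR⟩ := hmateC x y hxy
    have hxy' : x ≠ y := by rintro rfl; exact hirr _ hR
    obtain ⟨M1, a1, a2, a3, a4⟩ := apmM_erase hM hxy
    have nz := hIC z hz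
    have nz' := hIC z' hz'
    obtain ⟨M2, b1, b2, b3, b4⟩ := ext1 M1 (a1.trans hMX) a2 x (hCX hxC) z' (hIX z' hz')
      (by rw [a4]; tauto) (by rw [a4]; tauto) hxz
    obtain ⟨M3, c1, c2, c3, c4⟩ := ext1 M2 b1 b2 y (hCX hyC) z (hIX z hz)
      (by rw [b4, a4]; grind) (by rw [b4, a4]; grind) hyz
    have := hmax M3 c1 c2
    omega
  have f2 : ∀ x y, ((x, y) ∈ M ∨ (y, x) ∈ M) → ∀ x' y', ((x', y') ∈ M ∨ (y', x') ∈ M) →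
      x ≠ x' → y ≠ y' → x ≠ y' → y ≠ x' → ∀ z ∈ I, ∀ z' ∈ I, z ≠ z' → R x z → R x' z' →
      ¬ R y y' := by
    intro x y hxy x' y' hxy' n1 n2 n3 n4 z hz z' hz' hne hxz hxz' hyy
    obtain ⟨hxC, hyC, hR⟩ := hmateC x y hxy
    obtain ⟨hxC', hyC', hR'⟩ := hmateC x' y' hxy'
    have e1 : x ≠ y := by rintro rfl; exact hirr _ hR
    have e2 : x' ≠ y' := by rintro rfl; exact hirr _ hR'
    obtain ⟨M1, a1, a2, a3, a4⟩ := apmM_erase hM hxy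
    have hin : (x', y') ∈ M1 ∨ (y', x') ∈ M1 := by
      have : x' ∈ apmCov M1 := by rw [a4]; exact ⟨hxC', n1.symm, n4.symm⟩
      rw [mem_apmCov] at this
      obtain ⟨w, hw⟩ := this
      have hw' : w = y' := by
        have h2 := hM.2
        by_contra hne
        rcases hw with hw | hw <;> rcases hxy' with hx | hx
        · have := h2 _ (a1 hw) _ hx (by simp [hne]); tauto
        · have := h2 _ (a1 hw) _ hx (by simp [e2]); tauto
        · have := h2 _ (a1 hw) _ hx (by simp [e2]); tauto
        · have := h2 _ (a1 hw) _ hx (by simp [hne]); tauto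
      rw [hw'] at hw; exact hw
    obtain ⟨M2, b1, b2, b3, b4⟩ := apmM_erase a2 hin
    have nz := hIC z hz
    have nz' := hIC z' hz'
    obtain ⟨M3, c1, c2, c3, c4⟩ := ext1 M2 ((b1.trans a1).trans hMX) b2 x (hCX hxC) z (hIX z hz)
      (by rw [b4, a4]; tauto) (by rw [b4, a4]; tauto) hxz
    obtain ⟨M4, d1, d2, d3, d4⟩ := ext1 M3 c1 c2 x' (hCX hxC') z' (hIX z' hz')
      (by rw [c4, b4, a4]; grind) (by rw [c4, b4, a4]; grind) hxz'
    obtain ⟨M5, e1, e2, e3, e4⟩ := ext1 M4 d1 d2 y (hCX hyC) y' (hCX hyC')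
      (by rw [d4, c4, b4, a4]; grind) (by rw [d4, c4, b4, a4]; grind) hyy
    have := hmax M5 e1 e2
    omega
  -- mates
  have hmate' : ∀ x, ∃ y, x ∈ C → ((x, y) ∈ M ∨ (y, x) ∈ M) := by
    intro x
    by_cases hx : x ∈ C
    · obtain ⟨y, hy⟩ := hmate x hx; exact ⟨y, fun _ => hy⟩
    · exact ⟨x, fun h => absurd h hx⟩
  choose m hm using hmate'
  have hminj : ∀ x ∈ C, ∀ x' ∈ C, m x = m x' → x = x' := by
    intro x hx x' hx' h
    have h1 := hm x hx
    have h3 := hm x' hx'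
    rw [← h] at h3
    by_contra hne
    have n1 : x ≠ m x := by
      intro h; have := (hmateC _ _ h1).2.2; rw [← h] at this; exact hirr _ this
    have h2 := hM.2
    rcases h1 with h1 | h1 <;> rcases h3 with h3 | h3
    · have := h2 _ h1 _ h3 (by simp [hne]); tauto
    · have := h2 _ h1 _ h3 (by simp [n1]); tauto
    · have := h2 _ h1 _ h3 (by intro h; exact n1 (congrArg Prod.snd h)); tauto
    · have := h2 _ h1 _ h3 (by simp [hne]); tauto
  set A := C.filter (fun x => 2 ≤ (I.filter (fun z => R x z)).card) with hA
  have hAC : A ⊆ C := filter_subset _ _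
  have g1 : ∀ x ∈ A, (I.filter (fun z => R (m x) z)).card = 0 := by
    intro x hx
    obtain ⟨hxC, hx2⟩ := mem_filter.1 hx
    rw [card_eq_zero, filter_eq_empty_iff]
    intro z hz hR
    obtain ⟨z', hz', hne⟩ := Finset.exists_mem_ne (show 1 < _ from hx2) z
    rw [mem_filter] at hz'
    exact f1 x (m x) (hm x hxC) z hz z' hz'.1 hne.symm hz'.2 hR
  have g2 : ∀ x ∈ A, ∀ x' ∈ A, ¬ R (m x) (m x') := by
    intro x hx x' hx' hR
    obtain ⟨hxC, hx2⟩ := mem_filter.1 hx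
    obtain ⟨hxC', hx2'⟩ := mem_filter.1 hx'
    have n0 : x ≠ x' := by rintro rfl; exact hirr _ hR
    have n1 : m x ≠ m x' := fun h => n0 (hminj x hxC x' hxC' h)
    have n2 : x ≠ m x' := by intro h; have := g1 x' hx'; rw [← h] at this; omega
    have n3 : m x ≠ x' := by intro h; have := g1 x hx; rw [h] at this; omega
    obtain ⟨z, hz⟩ := Finset.card_pos.1 (show 0 < (I.filter (fun z => R x z)).card by omega)
    obtain ⟨z', hz', hne⟩ := Finset.exists_mem_ne (show 1 < _ from hx2') z
    rw [mem_filter] at hz hz'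
    exact f2 x (m x) (hm x hxC) x' (m x') (hm x' hxC') n0 n1 n2 n3 z hz.1 z' hz'.1 hne.symm
      hz.2 hz'.2 hR
  set A' := A.image m with hA'
  have hA'C : A' ⊆ C := by
    intro y hy
    obtain ⟨x, hx, rfl⟩ := mem_image.1 hy
    exact (hmateC _ _ (hm x (hAC hx))).2.1
  have hA'card : A'.card = A.card :=
    card_image_of_injOn fun x hx x' hx' h => hminj x (hAC hx) x' (hAC hx') h
  have hdisj : Disjoint A A' := by
    rw [disjoint_left]
    intro y hy hy'
    obtain ⟨x, hx, rfl⟩ := mem_image.1 hy'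
    have h1 := g1 x hx
    have h2 := (mem_filter.1 hy).2
    omega
  have hAA : (A ∪ A').card = 2 * A.card := by
    rw [card_union_of_disjoint hdisj, hA'card]; ring
  have hAA' : (A ∪ A') ⊆ C := union_subset hAC hA'C
  have hAle : A.card ≤ M.card := by have := card_le_card hAA'; omega
  have deg : ((C ×ˢ I).filter (fun p => R p.1 p.2)).card ≤
      A.card * I.card + (2 * M.card - 2 * A.card) := by
    have : ((C ×ˢ I).filter (fun p => R p.1 p.2)) ⊆
        (A ×ˢ I) ∪ ((C \ (A ∪ A')).biUnion
          (fun x => (I.filter (fun z => R x z)).image (fun z => (x, z)))) := by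
      rintro ⟨x, z⟩ hp
      simp only [mem_filter, mem_product] at hp
      obtain ⟨⟨hx, hz⟩, hR⟩ := hp
      simp only [mem_union, mem_product, mem_biUnion, mem_sdiff, mem_image, mem_filter]
      by_cases hxA : x ∈ A
      · exact Or.inl ⟨hxA, hz⟩
      · right
        refine ⟨x, ⟨hx, ?_⟩, z, ⟨hz, hR⟩, rfl⟩
        rintro (h | h)
        · exact hxA h
        · obtain ⟨w, hw, rfl⟩ := mem_image.1 h
          have := g1 w hw
          rw [card_eq_zero, filter_eq_empty_iff] at this
          exact this hz hR
    refine (card_le_card this).trans ((card_union_le _ _).trans ?_)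
    rw [card_product]
    refine Nat.add_le_add_left ?_ _
    refine (card_biUnion_le_card_mul _ _ 1 ?_).trans ?_
    · intro x hx
      rw [mem_sdiff] at hx
      refine card_image_le.trans ?_
      by_contra h
      exact hx.2 (mem_union_left _ (mem_filter.2 ⟨hx.1, by omega⟩))
    · rw [card_sdiff_of_subset hAA', hAA, hCcard]; omega
  have cc : ((C ×ˢ C).filter (fun p => R p.1 p.2)).card ≤
      (2 * M.card) * (2 * M.card) - A.card * A.card := by
    have : ((C ×ˢ C).filter (fun p => R p.1 p.2)) ⊆ (C ×ˢ C) \ (A' ×ˢ A') := by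
      rintro ⟨x, z⟩ hp
      simp only [mem_filter, mem_product] at hp
      simp only [mem_sdiff, mem_product]
      refine ⟨hp.1, ?_⟩
      rintro ⟨h1, h2⟩
      obtain ⟨w, hw, rfl⟩ := mem_image.1 h1
      obtain ⟨w', hw', rfl⟩ := mem_image.1 h2
      exact g2 w hw w' hw' hp.2
    refine (card_le_card this).trans ?_
    rw [card_sdiff_of_subset (product_subset_product hA'C hA'C), card_product, card_product,
      hCcard, hA'card]
  have tot : ((X ×ˢ X).filter (fun p => R p.1 p.2)).card ≤
      2 * ((C ×ˢ I).filter (fun p => R p.1 p.2)).card +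
      ((C ×ˢ C).filter (fun p => R p.1 p.2)).card := by
    have : ((X ×ˢ X).filter (fun p => R p.1 p.2)) ⊆
      (((C ×ˢ I).filter (fun p => R p.1 p.2)) ∪
        ((C ×ˢ I).filter (fun p => R p.1 p.2)).image Prod.swap) ∪
        ((C ×ˢ C).filter (fun p => R p.1 p.2)) := by
      rintro ⟨x, z⟩ hp
      simp only [mem_filter, mem_product] at hp
      obtain ⟨⟨hx, hz⟩, hR⟩ := hp
      simp only [mem_union, mem_filter, mem_product, mem_image, Prod.exists, Prod.swap_prod_mk,
        Prod.mk.injEq]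
      by_cases hxC : x ∈ C <;> by_cases hzC : z ∈ C
      · exact Or.inr ⟨⟨hxC, hzC⟩, hR⟩
      · exact Or.inl (Or.inl ⟨⟨hxC, mem_sdiff.2 ⟨hz, hzC⟩⟩, hR⟩)
      · exact Or.inl (Or.inr ⟨z, x, ⟨⟨hzC, mem_sdiff.2 ⟨hx, hxC⟩⟩, hsym _ _ hR⟩, rfl, rfl⟩)
      · exact absurd hR (f0 x (mem_sdiff.2 ⟨hx, hxC⟩) z (mem_sdiff.2 ⟨hz, hzC⟩))
    refine (card_le_card this).trans ((card_union_le _ _).trans ?_)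
    refine Nat.add_le_add_right ((card_union_le _ _).trans ?_) _
    have : (((C ×ˢ I).filter (fun p => R p.1 p.2)).image Prod.swap).card ≤ _ := card_image_le
    omega
  have := apm_arith t M.card r A.card I.card hIcard hAle hs hr
  omega

lemma apm_augment {V : Type*} [DecidableEq V] (Q P : Finset V) (hQP : Disjoint Q P)
    (H M D : Finset (Finset V)) (hMH : M ⊆ H)
    (hM : ∀ e ∈ M, ∀ f ∈ M, e ≠ f → Disjoint e f) (hD : D ⊆ M) (X : Finset V) (hXP : X ⊆ P)
    (hDX : ∀ f ∈ M, f ∉ D → Disjoint f X) (k : ℕ) (A B : Finset (V × V))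
    (hA : A.card = k) (hB : B.card = k)
    (hAd : ∀ p ∈ A, ∀ q ∈ A, p ≠ q → p.1 ≠ q.1 ∧ p.2 ≠ q.2)
    (hBd : ∀ p ∈ B, ∀ q ∈ B, p ≠ q → p.1 ≠ q.1 ∧ p.1 ≠ q.2 ∧ p.2 ≠ q.1 ∧ p.2 ≠ q.2)
    (hBX : B ⊆ X ×ˢ X)
    (hAm : ∀ q ∈ A, q.1 ∈ Q ∧ q.2 ∈ P ∧ q.1 ∉ M.biUnion id ∧ q.2 ∉ M.biUnion id ∧ q.2 ∉ X)
    (hAB : ∀ q ∈ A, ∀ p ∈ B, ({q.1, q.2, p.1, p.2} : Finset V) ∈ H) :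
    ∃ M' ⊆ H, (∀ e ∈ M', ∀ f ∈ M', e ≠ f → Disjoint e f) ∧ M'.card + D.card = M.card + k := by
  classical
  let φ : A ≃ B := Finset.equivOfCardEq (hA.trans hB.symm)
  let g : A → Finset V := fun q => {q.1.1, q.1.2, (φ q).1.1, (φ q).1.2}
  have hX : ∀ q : A, (φ q).1.1 ∈ X ∧ (φ q).1.2 ∈ X := fun q => mem_product.1 (hBX (φ q).2)
  have hQP' := Finset.disjoint_left.1 hQP
  have hg : ∀ q q' : A, q ≠ q' → Disjoint (g q) (g q') := by
    intro q q' hne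
    have h1 := hAd _ q.2 _ q'.2 (fun h => hne (Subtype.ext h))
    have h2 := hBd _ (φ q).2 _ (φ q').2 (fun h => hne (φ.injective (Subtype.ext h)))
    have h3 := hX q
    have h4 := hX q'
    have h5 := hAm _ q.2
    have h6 := hAm _ q'.2
    have e1 : q.1.1 ∉ P := hQP' h5.1
    have e2 : q'.1.1 ∉ P := hQP' h6.1
    have e3 : q.1.1 ∉ X := fun h => e1 (hXP h)
    have e4 : q'.1.1 ∉ X := fun h => e2 (hXP h)
    simp only [g, disjoint_left, mem_insert, mem_singleton]
    grind
  have hgM : ∀ q : A, ∀ f ∈ M, f ∉ D → Disjoint (g q) f := by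
    intro q f hf hfD
    have h3 := hX q
    have h5 := hAm _ q.2
    have h6 := Finset.disjoint_right.1 (hDX f hf hfD)
    have e1 : q.1.1 ∉ f := fun h => h5.2.2.1 (mem_biUnion.2 ⟨f, hf, h⟩)
    have e2 : q.1.2 ∉ f := fun h => h5.2.2.2.1 (mem_biUnion.2 ⟨f, hf, h⟩)
    simp only [g, disjoint_left, mem_insert, mem_singleton]
    rintro x (rfl | rfl | rfl | rfl)
    · exact e1
    · exact e2
    · exact h6 h3.1
    · exact h6 h3.2
  have hgne : ∀ q : A, (g q).Nonempty := fun q => ⟨q.1.1, by simp [g]⟩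
  have hginj : Function.Injective g := by
    intro q q' h
    by_contra hne
    have := hg q q' hne
    rw [h] at this
    exact (hgne q').ne_empty (disjoint_self.1 this)
  refine ⟨(M \ D) ∪ Finset.univ.image g, ?_, ?_, ?_⟩
  · refine union_subset (sdiff_subset.trans hMH) ?_
    intro e he
    obtain ⟨q, -, rfl⟩ := mem_image.1 he
    exact hAB _ q.2 _ (φ q).2
  · intro e he f hf hne
    simp only [mem_union, mem_sdiff, mem_image, mem_univ, true_and] at he hf
    rcases he with he | ⟨q, rfl⟩ <;> rcases hf with hf | ⟨q', rfl⟩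
    · exact hM e he.1 f hf.1 hne
    · exact (hgM q' e he.1 he.2).symm
    · exact hgM q f hf.1 hf.2
    · exact hg q q' (fun h => hne (by rw [h]))
  · rw [card_union_of_disjoint, card_image_of_injective _ hginj, card_univ, Fintype.card_coe, hA,
      card_sdiff_of_subset hD]
    · have := card_le_card hD; omega
    · rw [disjoint_left]
      intro e he he'
      obtain ⟨q, -, rfl⟩ := mem_image.1 he'
      rw [mem_sdiff] at he
      exact (hgne q).ne_empty (disjoint_self.1 (hgM q _ he.1 he.2))

lemma apm_real (m t l N PG PT σ ρ : ℝ) (hm : 2 ≤ m) (ht : 2 ≤ t) (hN : 0 ≤ N)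
    (h1 : t * (t - 1) * PG ≤ m * (m - 1) * PT)
    (h2 : N * (5 * m ^ 2 - 16 * m - 18 * ρ * m ^ 2 + 4 * (m - 1) * l) ≤ PG)
    (hρ : 18 * ρ ≤ σ) (hl : 3 * σ * m ≤ 4 * l) (hσm : 11 ≤ σ * (m - 2)) (hσt : 10 ≤ σ * (t - 1)) :
    N * (5 * t ^ 2 + 5 * t) ≤ PT := by
  have a1 : m * (m - 1) * (5 + σ) ≤ 5 * m ^ 2 - 16 * m - 18 * ρ * m ^ 2 + 4 * (m - 1) * l := by
    nlinarith [mul_le_mul_of_nonneg_left hl (show 0 ≤ m - 1 by linarith),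
      mul_le_mul_of_nonneg_right hρ (show 0 ≤ m ^ 2 by positivity),
      mul_le_mul_of_nonneg_left hσm (show 0 ≤ m by linarith)]
  have a2 : N * (m * (m - 1) * (5 + σ)) ≤ PG := (mul_le_mul_of_nonneg_left a1 hN).trans h2
  have ht1 : 0 ≤ t * (t - 1) := by nlinarith
  have a3 := (mul_le_mul_of_nonneg_left a2 ht1).trans h1
  have hm1 : 0 < m * (m - 1) := by nlinarith
  have a4 : t * (t - 1) * (5 + σ) * N ≤ PT := by
    refine le_of_mul_le_mul_left ?_ hm1
    linarith
  have a5 : 5 * t ^ 2 + 5 * t ≤ t * (t - 1) * (5 + σ) := by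
    nlinarith [mul_le_mul_of_nonneg_left hσt (show 0 ≤ t by linarith)]
  nlinarith [mul_le_mul_of_nonneg_left a5 hN]

lemma apm_deg {V : Type*} [Fintype V] [DecidableEq V] (Q P : Finset V)
    (hU : Q ∪ P = univ) (H : Finset (Finset V))
    (hH : ∀ e ∈ H, (e ∩ Q).card = 1 ∧ (e ∩ P).card = 3) (v u : V) (hv : v ∈ Q) (hu : u ∈ P) :
    2 * (H.filter (fun e => u ∈ e ∧ v ∈ e)).card ≤
      ((P ×ˢ P).filter (fun p => ({v, u, p.1, p.2} : Finset V) ∈ H)).card := by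
  have key : ∀ e ∈ H.filter (fun e => u ∈ e ∧ v ∈ e), ∃ a b, a ≠ b ∧ a ∈ P ∧ b ∈ P ∧
      ({v, u, a, b} : Finset V) = e := by
    intro e he
    obtain ⟨heH, hue, hve⟩ := mem_filter.1 he
    obtain ⟨h1, h3⟩ := hH e heH
    have e1 : e ∩ Q = {v} := by
      obtain ⟨w, hw⟩ := card_eq_one.1 h1
      have : v ∈ e ∩ Q := mem_inter.2 ⟨hve, hv⟩
      rw [hw, mem_singleton] at this
      rw [hw, this]
    have e2 : ((e ∩ P).erase u).card = 2 := by
      rw [card_erase_of_mem (mem_inter.2 ⟨hue, hu⟩), h3]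
    obtain ⟨a, b, hab, h⟩ := card_eq_two.1 e2
    have e3 : e ∩ P = {u, a, b} := by
      rw [← h, insert_erase (mem_inter.2 ⟨hue, hu⟩)]
    have ha : a ∈ e ∩ P := by rw [e3]; simp
    have hb : b ∈ e ∩ P := by rw [e3]; simp
    refine ⟨a, b, hab, (mem_inter.1 ha).2, (mem_inter.1 hb).2, ?_⟩
    have : e = (e ∩ Q) ∪ (e ∩ P) := by rw [← inter_union_distrib_left, hU, inter_univ]
    rw [this, e1, e3]
    rfl
  have hmaps : ∀ p ∈ ((P ×ˢ P).filter (fun p => ({v, u, p.1, p.2} : Finset V) ∈ H)),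
      (fun p : V × V => ({v, u, p.1, p.2} : Finset V)) p ∈ H.filter (fun e => u ∈ e ∧ v ∈ e) := by
    intro p hp
    simp only [mem_filter] at hp ⊢
    exact ⟨hp.2, by simp, by simp⟩
  rw [card_eq_sum_card_fiberwise hmaps, mul_comm, ← smul_eq_mul]
  refine card_nsmul_le_sum _ _ _ ?_
  intro e he
  obtain ⟨a, b, hab, ha, hb, hE⟩ := key e he
  have heH := (mem_filter.1 he).1
  have hE' : ({v, u, b, a} : Finset V) = e := by rw [pair_comm b a]; exact hE
  rw [← card_pair (show (a, b) ≠ (b, a) by simp [hab])]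
  refine card_le_card ?_
  intro p hp
  simp only [mem_insert, mem_singleton] at hp
  simp only [mem_filter, mem_product]
  rcases hp with rfl | rfl
  · exact ⟨⟨⟨ha, hb⟩, by simp only [hE]; exact heH⟩, hE⟩
  · exact ⟨⟨⟨hb, ha⟩, by simp only [hE']; exact heH⟩, hE'⟩


lemma apm_groups {V : Type*} [Fintype V] [DecidableEq V] (Q P : Finset V)
    (H M : Finset (Finset V))
    (hH : ∀ e ∈ H, (e ∩ Q).card = 1 ∧ (e ∩ P).card = 3) (m : ℕ) (hQ : Q.card = m)
    (hP : P.card = 3 * m) (hMH : M ⊆ H) (hM : ∀ e ∈ M, ∀ f ∈ M, e ≠ f → Disjoint e f) :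
    M.card + (Q \ M.biUnion id).card = m ∧
    (P \ M.biUnion id).card = 3 * (Q \ M.biUnion id).card ∧
    ∃ G GV : Finset (Finset V), GV ⊆ G ∧ G.card = m ∧ GV.card = (Q \ M.biUnion id).card ∧
      (∀ A ∈ G, A.card = 3) ∧ (∀ A ∈ G, ∀ B ∈ G, A ≠ B → Disjoint A B) ∧ G.biUnion id = P ∧
      (∀ e ∈ M, e ∩ P ∈ G ∧ e ∩ P ∉ GV) ∧
      (∀ e ∈ M, ∀ f ∈ M, e ∩ P = f ∩ P → e = f) := by
  have aux : ∀ (S : Finset V) (k : ℕ), (∀ e ∈ M, (e ∩ S).card = k) →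
      (S \ M.biUnion id).card + M.card * k = S.card := by
    intro S k hk
    have h1 : (M.biUnion (fun e => e ∩ S)).card = M.card * k := by
      rw [card_biUnion, sum_const_nat hk]
      intro e he f hf hne
      exact (hM e he f hf hne).mono inter_subset_left inter_subset_left
    have h2 : M.biUnion (fun e => e ∩ S) = M.biUnion id ∩ S := by
      ext x; simp only [mem_biUnion, mem_inter, id]; grind
    rw [← h1, h2, inter_comm]
    exact card_sdiff_add_card_inter _ _
  have aQ := aux Q 1 (fun e he => (hH e (hMH he)).1)
  have aP := aux P 3 (fun e he => (hH e (hMH he)).2)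
  have hc : (P \ M.biUnion id).card = 3 * (Q \ M.biUnion id).card := by omega
  refine ⟨by omega, hc, ?_⟩
  obtain ⟨GV, g1, g2, g3, g4⟩ := apm_triples _ _ hc
  have hinj : ∀ e ∈ M, ∀ f ∈ M, e ∩ P = f ∩ P → e = f := by
    intro e he f hf h
    by_contra hne
    have h1 : Disjoint (e ∩ P) (f ∩ P) :=
      (hM e he f hf hne).mono inter_subset_left inter_subset_left
    rw [h, disjoint_self] at h1
    have := (hH f (hMH hf)).2
    rw [h1] at this
    simp at this
  have hdis : ∀ e ∈ M, ∀ A ∈ GV, Disjoint (e ∩ P) A := by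
    intro e he A hA
    rw [disjoint_left]
    intro x hx hxA
    have := (mem_sdiff.1 ((g2 A hA).1 hxA)).2
    exact this (mem_biUnion.2 ⟨e, he, (mem_inter.1 hx).1⟩)
  have hnot : ∀ e ∈ M, e ∩ P ∉ GV := by
    intro e he h
    have := hdis e he _ h
    rw [disjoint_self] at this
    have h3 := (hH e (hMH he)).2
    rw [this] at h3
    simp at h3
  refine ⟨M.image (fun e => e ∩ P) ∪ GV, GV, subset_union_right, ?_, g1, ?_, ?_, ?_, ?_, hinj⟩
  · rw [card_union_of_disjoint, card_image_of_injOn, g1]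
    · omega
    · exact fun e he f hf h => hinj e he f hf h
    · rw [disjoint_left]
      intro A hA
      obtain ⟨e, he, rfl⟩ := mem_image.1 hA
      exact hnot e he
  · intro A hA
    rcases mem_union.1 hA with h | h
    · obtain ⟨e, he, rfl⟩ := mem_image.1 h
      exact (hH e (hMH he)).2
    · exact (g2 A h).2
  · intro A hA B hB hne
    rcases mem_union.1 hA with h | h <;> rcases mem_union.1 hB with h' | h'
    · obtain ⟨e, he, rfl⟩ := mem_image.1 h
      obtain ⟨f, hf, rfl⟩ := mem_image.1 h'
      exact (hM e he f hf (fun h => hne (by rw [h]))).mono inter_subset_left inter_subset_left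
    · obtain ⟨e, he, rfl⟩ := mem_image.1 h
      exact hdis e he B h'
    · obtain ⟨e, he, rfl⟩ := mem_image.1 h'
      exact (hdis e he A h).symm
    · exact g3 A h B h' hne
  · rw [union_biUnion, g4]
    ext x
    simp only [mem_union, mem_biUnion, mem_image, mem_sdiff, id]
    constructor
    · rintro (⟨A, ⟨e, _, rfl⟩, hx⟩ | hx)
      · exact (mem_inter.1 hx).2
      · exact hx.1
    · intro hx
      by_cases h : ∃ e ∈ M, x ∈ e
      · obtain ⟨e, he, hxe⟩ := h
        exact Or.inl ⟨e ∩ P, ⟨e, he, rfl⟩, mem_inter.2 ⟨hxe, hx⟩⟩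
      · exact Or.inr ⟨hx, h⟩
  · intro e he
    exact ⟨mem_union_left _ (mem_image_of_mem _ he), hnot e he⟩

/-- There is a set `T` of `t` groups on which the total link count is large. -/
lemma apm_sample {V : Type*} [DecidableEq V] (P : Finset V) (H : Finset (Finset V))
    (G GV : Finset (Finset V)) (hGV : GV ⊆ G) (hG3 : ∀ A ∈ G, A.card = 3)
    (hGd : ∀ A ∈ G, ∀ B ∈ G, A ≠ B → Disjoint A B) (hGP : G.biUnion id = P)
    (m t l : ℕ) (hGm : G.card = m) (hl : GV.card = l)
    (L : Finset (V × V)) (σ ρ : ℝ) (ht : 2 ≤ t) (htm : t ≤ m)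
    (hdeg : ∀ q ∈ L, (5 * m ^ 2 - 7 * m - 18 * ρ * m ^ 2 : ℝ) ≤
      ((P ×ˢ P).filter (fun p => ({q.1, q.2, p.1, p.2} : Finset V) ∈ H)).card)
    (hρ : 18 * ρ ≤ σ) (hl' : 3 * σ * m ≤ 4 * l) (hσm : 11 ≤ σ * (m - 2))
    (hσt : 10 ≤ σ * (t - 1)) :
    ∃ T ⊆ G, T.card = t ∧
      (L.card : ℝ) * (5 * t ^ 2 + 5 * t - 4 * t * (T.filter (· ∈ GV)).card) ≤
      ∑ q ∈ L, (((T.biUnion id ×ˢ T.biUnion id).filter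
        (fun p => ({q.1, q.2, p.1, p.2} : Finset V) ∈ H)).card : ℝ) := by
  classical
  let h : V → V → ℝ := fun x y => ∑ q ∈ L, if ({q.1, q.2, x, y} : Finset V) ∈ H then 1 else 0
  have hcount : ∀ A B : Finset V, ∑ q ∈ L, (((A ×ˢ B).filter
        (fun p => ({q.1, q.2, p.1, p.2} : Finset V) ∈ H)).card : ℝ) =
        ∑ x ∈ A, ∑ y ∈ B, h x y := by
    intro A B
    simp only [h, card_filter, Nat.cast_sum, Nat.cast_ite, Nat.cast_one, Nat.cast_zero,
      sum_product]
    rw [sum_comm]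
    refine sum_congr rfl fun x _ => ?_
    rw [sum_comm]
  have hnn : ∀ x y, 0 ≤ h x y := fun x y => sum_nonneg fun q _ => by split_ifs <;> norm_num
  have hub : ∀ x y, h x y ≤ L.card := by
    intro x y
    refine (sum_le_card_nsmul L _ 1 fun q _ => by split_ifs <;> norm_num).trans ?_
    simp
  let a : Finset V → Finset V → ℝ := fun A B => ∑ x ∈ A, ∑ y ∈ B, h x y
  have hann : ∀ A B, 0 ≤ a A B := fun A B => sum_nonneg fun x _ => sum_nonneg fun y _ => hnn x y
  have hadd : ∀ T ⊆ G, ∑ A ∈ T, ∑ B ∈ T, a A B = a (T.biUnion id) (T.biUnion id) := by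
    intro T hT
    have hd : Set.PairwiseDisjoint (T : Set (Finset V)) id :=
      fun A hA B hB hne => hGd A (hT hA) B (hT hB) hne
    simp only [a]
    rw [sum_biUnion hd]
    refine sum_congr rfl fun A _ => ?_
    rw [sum_comm]
    refine sum_congr rfl fun x _ => ?_
    rw [sum_biUnion hd]
    rfl
  let w : Finset V → ℝ := fun A => if A ∈ GV then 1 else 0
  have hw : ∀ A, 0 ≤ w A := fun A => by simp only [w]; split_ifs <;> norm_num
  let N : ℝ := L.card
  have hN : 0 ≤ N := Nat.cast_nonneg _
  let f : Finset V → Finset V → ℝ := fun A B => a A B + 2 * N * (w A + w B)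
  have hfnn : ∀ A B, 0 ≤ f A B := fun A B => by
    have := hann A B; have := hw A; have := hw B; positivity
  let F : Finset V → Finset V → ℝ := fun A B => if A = B then 0 else f A B
  have hFf : ∀ A B, F A B ≤ f A B := fun A B => by
    simp only [F]; split_ifs
    · exact hfnn A B
    · exact le_rfl
  have hsumf : ∀ T ⊆ G, ∑ A ∈ T, ∑ B ∈ T, f A B = a (T.biUnion id) (T.biUnion id) +
      4 * N * T.card * (T.filter (· ∈ GV)).card := by
    intro T hT
    have hw' : ∑ A ∈ T, w A = (T.filter (· ∈ GV)).card := by simp only [w, sum_boole]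
    simp only [f, sum_add_distrib, hadd T hT, ← mul_sum, mul_add, sum_const, nsmul_eq_mul, hw']
    ring
  obtain ⟨T, hTG, hTt, hT⟩ := apm_avg F (fun A => by simp [F]) t ht (m - t) G (by omega)
  refine ⟨T, hTG, hTt, ?_⟩
  have hPT : ∑ A ∈ T, ∑ B ∈ T, F A B ≤ a (T.biUnion id) (T.biUnion id) +
      4 * N * T.card * (T.filter (· ∈ GV)).card := by
    rw [← hsumf T hTG]
    exact sum_le_sum fun A _ => sum_le_sum fun B _ => hFf A B
  have hPG : N * (5 * m ^ 2 - 16 * m - 18 * ρ * m ^ 2 + 4 * (m - 1) * l) ≤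
      ∑ A ∈ G, ∑ B ∈ G, F A B := by
    have e1 : ∀ A ∈ G, ∑ B ∈ G, F A B = ∑ B ∈ G, f A B - f A A := by
      intro A hA
      rw [← add_sum_erase G (F A) hA, ← add_sum_erase G (f A) hA]
      have : F A A = 0 := by simp [F]
      rw [this]
      have : ∑ B ∈ G.erase A, F A B = ∑ B ∈ G.erase A, f A B :=
        sum_congr rfl fun B hB => by simp [F, (ne_of_mem_erase hB).symm]
      rw [this]; ring
    rw [sum_congr rfl e1, sum_sub_distrib, hsumf G subset_rfl, hGP]
    have e2 : G.filter (· ∈ GV) = GV := by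
      ext A; simp only [mem_filter]; exact ⟨fun h => h.2, fun h => ⟨hGV h, h⟩⟩
    rw [e2, hl, hGm]
    have e3 : ∑ A ∈ G, f A A ≤ 9 * N * m + 4 * N * l := by
      have : ∀ A ∈ G, f A A ≤ 9 * N + 4 * N * w A := by
        intro A hA
        have : a A A ≤ 9 * N := by
          have h1 : a A A ≤ ∑ x ∈ A, ∑ y ∈ A, N :=
            sum_le_sum fun x _ => sum_le_sum fun y _ => hub x y
          simp only [sum_const, hG3 A hA, nsmul_eq_mul] at h1
          push_cast at h1
          linarith
        simp only [f]; linarith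
      refine (sum_le_sum this).trans ?_
      rw [sum_add_distrib, ← mul_sum G w]
      have hw' : ∑ A ∈ G, w A = l := by simp only [w, sum_boole]; rw [e2, hl]
      rw [hw']
      simp [hGm]; linarith
    have e4 : N * (5 * m ^ 2 - 7 * m - 18 * ρ * m ^ 2) ≤ a P P := by
      have := card_nsmul_le_sum L _ _ hdeg
      rw [hcount, nsmul_eq_mul] at this
      exact this
    nlinarith
  rw [hGm] at hT
  have ht' : (2 : ℝ) ≤ t := by exact_mod_cast ht
  have hm' : (2 : ℝ) ≤ m := by exact_mod_cast (ht.trans htm)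
  have := apm_real m t l N _ _ σ ρ hm' ht' hN hT hPG hρ hl' hσm hσt
  rw [hcount]
  rw [hTt] at hPT
  have h3 : a (T.biUnion id) (T.biUnion id) =
    ∑ x ∈ T.biUnion id, ∑ y ∈ T.biUnion id, h x y := rfl
  rw [← h3]
  have h4 : (L.card : ℝ) = N := rfl
  rw [h4]
  nlinarith


lemma apm_core {V : Type*} [Fintype V] [DecidableEq V] (Q P : Finset V) (hQP : Disjoint Q P)
    (H M : Finset (Finset V))
    (hH : ∀ e ∈ H, (e ∩ Q).card = 1 ∧ (e ∩ P).card = 3) (m : ℕ) (hQ : Q.card = m)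
    (hP : P.card = 3 * m) (hMH : M ⊆ H) (hM : ∀ e ∈ M, ∀ f ∈ M, e ≠ f → Disjoint e f)
    (hmax : ∀ M' ⊆ H, (∀ e ∈ M', ∀ f ∈ M', e ≠ f → Disjoint e f) → M'.card ≤ M.card)
    (t : ℕ) (σ ρ : ℝ) (ht : 2 ≤ t) (htm : t ≤ m)
    (hdeg : ∀ v ∈ Q, ∀ u ∈ P, (5 * m ^ 2 - 7 * m - 18 * ρ * m ^ 2 : ℝ) ≤
      ((P ×ˢ P).filter (fun p => ({v, u, p.1, p.2} : Finset V) ∈ H)).card)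
    (hρ : 18 * ρ ≤ σ) (hσm : 11 ≤ σ * (m - 2)) (hσt : 10 ≤ σ * (t - 1))
    (hl' : 3 * σ * m ≤ 4 * (Q \ M.biUnion id).card)
    (hbig : 3 * t * (3 * t + 2 ^ (3 * t * (3 * t)) * (t * 4)) < (Q \ M.biUnion id).card) :
    False := by
  classical
  obtain ⟨hMl, hLP, G, GV, hGVG, hGm, hGVl, hG3, hGd, hGP, hMG, hMinj⟩ :=
    apm_groups Q P H M hH m hQ hP hMH hM
  set LQ := Q \ M.biUnion id with hLQ
  set LP := P \ M.biUnion id with hLPd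
  set l := LQ.card with hl
  obtain ⟨T, hTG, hTt, hT⟩ := apm_sample P H G GV hGVG hG3 hGd hGP m t l hGm hGVl (LQ ×ˢ LP) σ ρ
    ht htm (fun q hq => hdeg q.1 (mem_sdiff.1 (mem_product.1 hq).1).1 q.2
      (mem_sdiff.1 (mem_product.1 hq).2).1) hρ hl' hσm hσt
  set X := T.biUnion id with hX
  have hXcard : X.card = 3 * t := by
    rw [hX, card_biUnion]
    · simp only [id]
      rw [sum_const_nat (m := 3) (fun A hA => hG3 A (hTG hA)), hTt, mul_comm]
    · exact fun A hA B hB hne => hGd A (hTG hA) B (hTG hB) hne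
  have hXP : X ⊆ P := by
    rw [← hGP]; exact biUnion_subset_biUnion_of_subset_left _ hTG
  obtain ⟨r, hr⟩ : ∃ r, r + (T.filter (· ∈ GV)).card = t :=
    ⟨t - (T.filter (· ∈ GV)).card, by have := card_filter_le T (· ∈ GV); omega⟩
  have hrt : r ≤ t := by omega
  let c : V × V → ℕ := fun q => ((X ×ˢ X).filter
        (fun p => ({q.1, q.2, p.1, p.2} : Finset V) ∈ H)).card
  have hcub : ∀ q, c q ≤ 9 * t ^ 2 := by
    intro q
    refine (card_filter_le _ _).trans ?_
    rw [card_product, hXcard]; apply le_of_eq; ring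
  set thr := t ^ 2 + 4 * t * r + 4 * t with hthr
  have hT' : (LQ ×ˢ LP).card * (thr + t) ≤ ∑ q ∈ LQ ×ˢ LP, c q := by
    have hr' : (r : ℝ) + (T.filter (· ∈ GV)).card = t := by exact_mod_cast hr
    have hw : ((T.filter (· ∈ GV)).card : ℝ) = t - r := by linarith
    rw [hw] at hT
    have : (((LQ ×ˢ LP).card * (thr + t) : ℕ) : ℝ) ≤ ((∑ q ∈ LQ ×ˢ LP, c q : ℕ) : ℝ) := by
      push_cast [hthr]
      refine le_trans (le_of_eq ?_) hT
      ring
    exact_mod_cast this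
  set good := (LQ ×ˢ LP).filter (fun q => thr < c q) with hgood
  have hsum : ∑ q ∈ LQ ×ˢ LP, c q ≤ (LQ ×ˢ LP).card * thr + good.card * (9 * t ^ 2) := by
    have : ∀ q ∈ LQ ×ˢ LP, c q ≤ thr + (if thr < c q then 9 * t ^ 2 else 0) := by
      intro q _
      split_ifs with h
      · exact (hcub q).trans (Nat.le_add_left _ _)
      · omega
    refine (sum_le_sum this).trans ?_
    rw [sum_add_distrib, sum_const, smul_eq_mul, ← sum_filter, sum_const, smul_eq_mul]
  have hgoodcard : l * l ≤ 3 * t * good.card := by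
    have h1 : (LQ ×ˢ LP).card * t ≤ good.card * (9 * t ^ 2) := by
      have := hT'.trans hsum
      rw [mul_add] at this
      omega
    rw [card_product, hLP, ← hl] at h1
    have h2 : (3 * t) * (l * l) ≤ (3 * t) * (3 * t * good.card) := by nlinarith
    exact Nat.le_of_mul_le_mul_left h2 (by omega)
  set good' := good.filter (fun q => q.2 ∉ X) with hgood'
  have hg1 : good.card ≤ good'.card + l * (3 * t) := by
    rw [← card_filter_add_card_filter_not (s := good) (fun q => q.2 ∉ X)]
    refine Nat.add_le_add_left ?_ _
    rw [hl, ← hXcard, ← card_product]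
    refine card_le_card ?_
    intro q hq
    simp only [mem_filter, not_not] at hq
    have := (mem_filter.1 hq.1).1
    exact mem_product.2 ⟨(mem_product.1 this).1, hq.2⟩
  have hg2 : 2 ^ (3 * t * (3 * t)) * (r * (l + 3 * l)) < good'.card := by
    by_contra hcon
    push Not at hcon
    set K := 2 ^ (3 * t * (3 * t)) with hK
    have h1 : K * (r * (l + 3 * l)) ≤ K * (t * (l + 3 * l)) :=
      Nat.mul_le_mul_left _ (Nat.mul_le_mul_right _ hrt)
    have h2 : good.card ≤ K * (t * (l + 3 * l)) + l * (3 * t) := by omega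
    have h3 := hgoodcard.trans (Nat.mul_le_mul_left (3 * t) h2)
    have h4 : 3 * t * (K * (t * (l + 3 * l)) + l * (3 * t)) =
        (3 * t * (3 * t + K * (t * 4))) * l := by ring
    rw [h4] at h3
    have hlpos : 0 < l := by omega
    have := Nat.le_of_mul_le_mul_right h3 hlpos
    omega
  have hEG : ∀ q, ∃ B : Finset (V × V), q ∈ good' → B ⊆ X ×ˢ X ∧ B.card = r + 1 ∧
      ApmM (fun x y => ({q.1, q.2, x, y} : Finset V) ∈ H) B := by
    intro q
    by_cases hq : q ∈ good'
    · obtain ⟨hqg, hqX⟩ := mem_filter.1 hq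
      obtain ⟨hqL, hqc⟩ := mem_filter.1 hqg
      have hqQ := (mem_sdiff.1 (mem_product.1 hqL).1).1
      have hqP := (mem_sdiff.1 (mem_product.1 hqL).2).1
      obtain ⟨B, h1, h2, h3⟩ := apm_EG (fun x y => ({q.1, q.2, x, y} : Finset V) ∈ H)
        (fun x y h => by rw [pair_comm y x]; exact h)
        (fun x h => by
          have h3 := (hH _ h).2
          have h4 : ({q.1, q.2, x, x} : Finset V) ∩ P ⊆ {q.2, x} := by
            intro y hy
            simp only [mem_inter, mem_insert, mem_singleton] at hy ⊢
            rcases hy with ⟨rfl | rfl | rfl | rfl, hyP⟩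
            · exact absurd hyP (Finset.disjoint_left.1 hQP hqQ)
            · exact Or.inl rfl
            · exact Or.inr rfl
            · exact Or.inr rfl
          have h5 := card_le_card h4
          have h6 := card_le_two (a := q.2) (b := x)
          omega)
        X t r hXcard hrt (by
          have := hqc
          simp only [c] at this
          convert this)
      exact ⟨B, fun _ => ⟨h1, h2, h3⟩⟩
    · exact ⟨∅, fun h => absurd h hq⟩
  choose f hf using hEG
  obtain ⟨B, hBmem, hB⟩ := exists_lt_card_fiber_of_mul_lt_card_of_maps_to
    (s := good') (t := (X ×ˢ X).powerset) (f := f) (n := r * (l + 3 * l))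
    (fun q hq => mem_powerset.2 (hf q hq).1)
    (by rw [card_powerset, card_product, hXcard]; exact hg2)
  obtain ⟨A, hAs, hAc, hAd⟩ := apm_bip LQ LP (good'.filter (fun q => f q = B))
    (fun q hq => (mem_filter.1 (mem_filter.1 (mem_filter.1 hq).1).1).1) r
    (by rw [hLP, ← hl]; exact hB)
  have hAg : ∀ q ∈ A, q ∈ good' ∧ f q = B := fun q hq => mem_filter.1 (hAs hq)
  obtain ⟨q0, hq0⟩ := card_pos.1 (show 0 < A.card by omega)
  have hB0 := hf q0 (hAg q0 hq0).1
  rw [(hAg q0 hq0).2] at hB0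
  obtain ⟨M', h1, h2, h3⟩ := apm_augment Q P hQP H M (M.filter (fun e => e ∩ P ∈ T)) hMH hM
    (filter_subset _ _) X hXP
    (by
      intro e he heD
      have heT : e ∩ P ∉ T := fun h => heD (mem_filter.2 ⟨he, h⟩)
      rw [disjoint_left]
      intro x hxe hxX
      obtain ⟨A, hA, hxA⟩ := mem_biUnion.1 hxX
      have hne : e ∩ P ≠ A := fun h => heT (h ▸ hA)
      exact disjoint_left.1 (hGd _ (hMG e he).1 A (hTG hA) hne)
        (mem_inter.2 ⟨hxe, hXP hxX⟩) hxA)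
    (r + 1) A B hAc hB0.2.1 hAd hB0.2.2.2 hB0.1
    (by
      intro q hq
      obtain ⟨hqg, hqX⟩ := mem_filter.1 (hAg q hq).1
      have hqL := mem_product.1 (mem_filter.1 hqg).1
      have ha := mem_sdiff.1 hqL.1
      have hb := mem_sdiff.1 hqL.2
      exact ⟨ha.1, hb.1, ha.2, hb.2, hqX⟩)
    (by
      intro q hq p hp
      have := hf q (hAg q hq).1
      rw [(hAg q hq).2] at this
      exact this.2.2.1 p hp)
  have h4 := hmax M' h1 h2
  have h5 : (M.filter (fun e => e ∩ P ∈ T)).card ≤ (T.filter (fun A => ¬ A ∈ GV)).card := by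
    refine card_le_card_of_injOn (fun e => e ∩ P) ?_ ?_
    · intro e he
      obtain ⟨he, heT⟩ := mem_filter.1 he
      exact mem_filter.2 ⟨heT, (hMG e he).2⟩
    · intro e he e' he' h
      exact hMinj e (mem_filter.1 he).1 e' (mem_filter.1 he').1 h
  have h6 := card_filter_add_card_filter_not (s := T) (· ∈ GV)
  omega

end Helpers

/-- For every `σ > 0` there exists `ε₀ > 0` such that for all `0 < ε ≤ ε₀`
and `0 < ρ ≤ ε/4` there exists `N` such that for every `n ∈ 3ℤ` with `n ≥ N`: if `H` is
a (1,3)-partite 4-graph with classes `Q, P`, `3|Q| = |P| = n`, not `ε`-close to any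
`H_{1,3}(n, n/3)` on `V(H)` (larger class `P`, smaller class `Q`), and
`d_H({u,v}) ≥ C(n-1,2) - C(2n/3,2) - ρn²` for all `v ∈ Q`, `u ∈ P`, then `H` contains a
matching covering all but at most `σn` vertices. -/
theorem almost_perfect_matching (σ : ℝ) (hσ : 0 < σ) :
    ∃ ε₀ : ℝ, 0 < ε₀ ∧ ∀ ε ρ : ℝ, 0 < ε → ε ≤ ε₀ → 0 < ρ → ρ ≤ ε / 4 →
      ∃ N : ℕ, ∀ n : ℕ, 3 ∣ n → N ≤ n →
        ∀ (Q P : Finset (Fin (n + n / 3))) (H : Finset (Finset (Fin (n + n / 3)))),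
          Disjoint Q P → Q ∪ P = Finset.univ →
          Q.card = n / 3 → P.card = n →
          (∀ e ∈ H, (e ∩ Q).card = 1 ∧ (e ∩ P).card = 3) →
          (∀ U W : Finset (Fin (n + n / 3)), Disjoint U W → U ∪ W = P →
            U.card = 2 * n / 3 → W.card = n / 3 →
            ε * ((n + n / 3 : ℕ) : ℝ) ^ 4 ≤ (((extremalH13 Q P W) \ H).card : ℝ)) →
          (∀ v ∈ Q, ∀ u ∈ P,
            (Nat.choose (n - 1) 2 : ℝ) - (Nat.choose (2 * n / 3) 2 : ℝ) - ρ * (n : ℝ) ^ 2 ≤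
              ((H.filter (fun e => u ∈ e ∧ v ∈ e)).card : ℝ)) →
          ∃ M ⊆ H, (∀ e ∈ M, ∀ f ∈ M, e ≠ f → Disjoint e f) ∧
            (((Finset.univ \ M.biUnion id : Finset (Fin (n + n / 3))).card : ℝ) ≤ σ * n) := by
  refine ⟨σ / 18, by positivity, ?_⟩
  intro ε ρ hε hε0 hρ0 hρ
  -- parameters
  set t : ℕ := ⌈10 / σ⌉₊ + 2 with ht
  set K : ℕ := 3 * t * (3 * t + 2 ^ (3 * t * (3 * t)) * (t * 4)) with hK
  set m0 : ℕ := ⌈11 / σ⌉₊ + 2 + t + ⌈4 * (K + 1 : ℝ) / (3 * σ)⌉₊ with hm0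
  have hσt : 10 ≤ σ * ((t : ℝ) - 1) := by
    have h1 := Nat.le_ceil (10 / σ)
    have h2 : (t : ℝ) = ⌈10 / σ⌉₊ + 2 := by rw [ht]; push_cast; ring
    rw [div_le_iff₀ hσ] at h1
    rw [h2]; nlinarith
  have ht2 : 2 ≤ t := by omega
  have htm0 : t ≤ m0 := by omega
  clear_value m0 K t
  refine ⟨3 * m0, ?_⟩
  rintro n ⟨m, rfl⟩ hn Q P H hQP hU hQ hP hH - hdeg
  have hmm : m0 ≤ m := by omega
  have hdiv : 3 * m / 3 = m := by omega
  have hdiv2 : 2 * (3 * m) / 3 = 2 * m := by omega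
  have hQ' : Q.card = m := hQ.trans hdiv
  have hm0' : (m0 : ℝ) = ⌈11 / σ⌉₊ + 2 + t + ⌈4 * (K + 1 : ℝ) / (3 * σ)⌉₊ := by
    rw [hm0]; push_cast; ring
  have hmr : (m0 : ℝ) ≤ m := by exact_mod_cast hmm
  have c1 := Nat.le_ceil (11 / σ)
  have c2 := Nat.le_ceil (4 * (K + 1 : ℝ) / (3 * σ))
  have t0 : (0 : ℝ) ≤ t := Nat.cast_nonneg _
  have d1 : (0 : ℝ) ≤ ⌈11 / σ⌉₊ := Nat.cast_nonneg _
  have d2 : (0 : ℝ) ≤ ⌈4 * (K + 1 : ℝ) / (3 * σ)⌉₊ := Nat.cast_nonneg _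
  have hσm : 11 ≤ σ * ((m : ℝ) - 2) := by
    rw [div_le_iff₀ hσ] at c1
    nlinarith
  have hmK : 4 * ((K : ℝ) + 1) ≤ 3 * σ * m := by
    rw [div_le_iff₀ (by positivity)] at c2
    nlinarith
  obtain ⟨M, hMmem, hMmax⟩ := Finset.exists_max_image
    (H.powerset.filter (fun M => ∀ e ∈ M, ∀ f ∈ M, e ≠ f → Disjoint e f)) Finset.card
    ⟨∅, by simp⟩
  rw [Finset.mem_filter, Finset.mem_powerset] at hMmem
  obtain ⟨hMH, hM⟩ := hMmem
  refine ⟨M, hMH, hM, ?_⟩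
  by_contra hcon
  push Not at hcon
  obtain ⟨-, hLP, -⟩ := apm_groups Q P H M hH m hQ' hP hMH hM
  have hleft : (Finset.univ \ M.biUnion id).card = 4 * (Q \ M.biUnion id).card := by
    rw [← hU, Finset.union_sdiff_distrib, Finset.card_union_of_disjoint
      (hQP.mono Finset.sdiff_subset Finset.sdiff_subset), hLP]
    ring
  rw [hleft] at hcon
  push_cast at hcon
  refine apm_core Q P hQP H M hH m hQ' hP hMH hM
    (fun M' h1 h2 => hMmax M' (by rw [Finset.mem_filter, Finset.mem_powerset]; exact ⟨h1, h2⟩))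
    t σ ρ ht2 (htm0.trans hmm) ?_ (by linarith) hσm hσt (by linarith) ?_
  · intro v hv u hu
    have h1 := hdeg v hv u hu
    rw [hdiv2] at h1
    have h2 := apm_deg Q P hU H hH v u hv hu
    have h2' : (2 : ℝ) * ((H.filter (fun e => u ∈ e ∧ v ∈ e)).card : ℝ) ≤
      ((P ×ˢ P).filter (fun p => ({v, u, p.1, p.2} : Finset _) ∈ H)).card := by exact_mod_cast h2
    refine le_trans ?_ h2'
    rw [Nat.cast_choose_two, Nat.cast_choose_two, Nat.cast_sub (by omega)] at h1
    push_cast at h1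
    nlinarith
  · have : ((K : ℝ)) < (Q \ M.biUnion id).card := by linarith
    rw [← hK]
    exact_mod_cast this
end

section
/- For every integer k ≥ 2 and reals r ≥ 1 and a > 0, there exist γ = γ(k, r, a) > 0 and d_0 = d_0(k, r, a) such that for every n and every D ≥ d_0 the following holds: every k-uniform hypergraph H on n vertices in which all vertices have positive degree and which satisfies (1) all vertices x, except at most γn of them, have degree d(x) within the interval [(1−γ)D, (1+γ)D]; (2) every vertex x has d(x) < rD; and (3) every pair of distinct vertices x, y has codegree d({x, y}) < γD, contains a cover of at most (1 + a)(n/k) edges. -/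
open Finset
set_option linter.unusedSectionVars false

namespace PS
variable {α : Type*} [DecidableEq α]

/-- edges containing `x` -/
def inc (H : Finset (Finset α)) (x : α) : Finset (Finset α) := H.filter (fun e => x ∈ e)

/-- degree -/
noncomputable def deg (H : Finset (Finset α)) (x : α) : ℝ := ((H.filter (fun e => x ∈ e)).card : ℝ)

/-- codegree -/
noncomputable def cod (H : Finset (Finset α)) (x y : α) : ℝ :=
  ((H.filter (fun e => x ∈ e ∧ y ∈ e)).card : ℝ)

/-- edges meeting `X` -/
def touch (H : Finset (Finset α)) (X : Finset α) : Finset (Finset α) :=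
  H.filter (fun g => ¬ Disjoint g X)

/-- expectation over the random subset of `H` keeping each edge with probability `1 - q` -/
noncomputable def Ex (H : Finset (Finset α)) (q : ℝ) (f : Finset (Finset α) → ℝ) : ℝ :=
  ∑ S ∈ H.powerset, (1 - q) ^ S.card * q ^ (H.card - S.card) * f S

/-- indicator that `S` avoids all edges meeting `X` -/
noncomputable def avd (H : Finset (Finset α)) (X : Finset α) (S : Finset (Finset α)) : ℝ :=
  if Disjoint S (touch H X) then 1 else 0

/-- surviving vertices -/
def surv (V : Finset α) (S : Finset (Finset α)) : Finset α := V.filter (fun x => ∀ e ∈ S, x ∉ e)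

/-- surviving edges -/
def res (H : Finset (Finset α)) (S : Finset (Finset α)) : Finset (Finset α) :=
  H.filter (fun e => ∀ g ∈ S, Disjoint g e)

lemma Ex_const (H : Finset (Finset α)) (q c : ℝ) : Ex H q (fun _ => c) = c := by
  unfold Ex
  rw [← Finset.sum_mul, Finset.sum_pow_mul_eq_add_pow]
  simp

lemma Ex_add (H : Finset (Finset α)) (q : ℝ) (f g : Finset (Finset α) → ℝ) :
    Ex H q (fun S => f S + g S) = Ex H q f + Ex H q g := by
  simp [Ex, mul_add, Finset.sum_add_distrib]

lemma Ex_sub (H : Finset (Finset α)) (q : ℝ) (f g : Finset (Finset α) → ℝ) :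
    Ex H q (fun S => f S - g S) = Ex H q f - Ex H q g := by
  simp [Ex, mul_sub, Finset.sum_sub_distrib]

lemma Ex_smul (H : Finset (Finset α)) (q c : ℝ) (f : Finset (Finset α) → ℝ) :
    Ex H q (fun S => c * f S) = c * Ex H q f := by
  simp only [Ex, Finset.mul_sum]
  exact Finset.sum_congr rfl fun _ _ => by ring

lemma Ex_sum {ι : Type*} (H : Finset (Finset α)) (q : ℝ) (s : Finset ι)
    (f : ι → Finset (Finset α) → ℝ) :
    Ex H q (fun S => ∑ i ∈ s, f i S) = ∑ i ∈ s, Ex H q (f i) := by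
  simp only [Ex, Finset.mul_sum]
  exact Finset.sum_comm

lemma Ex_congr (H : Finset (Finset α)) (q : ℝ) (f g : Finset (Finset α) → ℝ)
    (h : ∀ S ⊆ H, f S = g S) : Ex H q f = Ex H q g := by
  unfold Ex
  exact Finset.sum_congr rfl fun S hS => by rw [h S (Finset.mem_powerset.1 hS)]

lemma exists_le_Ex (H : Finset (Finset α)) (q : ℝ) (h0 : 0 ≤ q) (h1 : q ≤ 1)
    (f : Finset (Finset α) → ℝ) : ∃ S ⊆ H, f S ≤ Ex H q f := by
  by_contra! hcon
  have h2 : Ex H q (fun S => f S - Ex H q f) = 0 := by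
    rw [Ex_sub, Ex_const, sub_self]
  have h3 : ∀ S ∈ H.powerset, 0 ≤ (1 - q) ^ S.card * q ^ (H.card - S.card) * (f S - Ex H q f) := by
    intro S hS
    have := hcon S (Finset.mem_powerset.1 hS)
    have h4 : 0 ≤ 1 - q := by linarith
    have h5 : 0 ≤ f S - Ex H q f := by linarith
    positivity
  have h6 := (Finset.sum_eq_zero_iff_of_nonneg h3).1 h2
  have h7 : Ex H q (fun _ => (1:ℝ)) = 0 := by
    unfold Ex
    apply Finset.sum_eq_zero
    intro S hS
    have h8 := h6 S hS
    have := hcon S (Finset.mem_powerset.1 hS)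
    rcases mul_eq_zero.1 h8 with h | h
    · simp [h]
    · linarith
  rw [Ex_const] at h7
  norm_num at h7

lemma Ex_avoid (H A : Finset (Finset α)) (q : ℝ) (hA : A ⊆ H) :
    Ex H q (fun S => if Disjoint S A then 1 else 0) = q ^ A.card := by
  have h1 : Ex (H \ A) q (fun _ => (1:ℝ)) = 1 := Ex_const _ _ _
  unfold Ex at *
  simp only [mul_ite, mul_one, mul_zero] at *
  rw [← Finset.sum_filter]
  have h2 : H.powerset.filter (fun S => Disjoint S A) = (H \ A).powerset := by
    ext S
    simp only [Finset.mem_filter, Finset.mem_powerset, Finset.subset_sdiff]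
  rw [h2]
  have h5 := congrArg (q ^ A.card * ·) h1
  simp only [mul_one, Finset.mul_sum] at h5
  rw [← h5]
  refine Finset.sum_congr rfl fun S hS => ?_
  have hS' := Finset.card_le_card (Finset.mem_powerset.1 hS)
  have h3 : (H \ A).card + A.card = H.card := Finset.card_sdiff_add_card_eq_card hA
  have h4 : H.card - S.card = A.card + ((H \ A).card - S.card) := by omega
  rw [h4, pow_add]
  ring

lemma Ex_avd (H : Finset (Finset α)) (X : Finset α) (q : ℝ) :
    Ex H q (avd H X) = q ^ (touch H X).card :=
  Ex_avoid H (touch H X) q (Finset.filter_subset _ _)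

lemma Ex_card (H : Finset (Finset α)) (q : ℝ) :
    Ex H q (fun S => (S.card : ℝ)) = H.card * (1 - q) := by
  have h : ∀ S ⊆ H, (S.card : ℝ) = ∑ e ∈ H, (1 - (if Disjoint S {e} then (1:ℝ) else 0)) := by
    intro S hS
    have : ∀ e ∈ H, (1 - (if Disjoint S {e} then (1:ℝ) else 0)) = if e ∈ S then 1 else 0 := by
      intro e _
      by_cases h : e ∈ S <;> simp [h]
    rw [Finset.sum_congr rfl this]
    simp [Finset.inter_eq_right.2 hS]
  rw [Ex_congr _ _ _ _ h, Ex_sum]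
  rw [Finset.sum_congr rfl (g := fun _ => 1 - q)]
  · rw [Finset.sum_const, nsmul_eq_mul]
  · intro e he
    rw [Ex_sub, Ex_const, Ex_avoid _ _ _ (by simpa using he)]
    simp

lemma avd_eq (H : Finset (Finset α)) (X : Finset α) (S : Finset (Finset α)) (hS : S ⊆ H) :
    avd H X S = if ∀ g ∈ S, Disjoint g X then 1 else 0 := by
  unfold avd touch
  congr 1
  rw [Finset.disjoint_left]
  simp only [Finset.mem_filter, not_and, not_not, eq_iff_iff]
  exact ⟨fun h g hg => h hg (hS hg), fun h g hg _ => h g hg⟩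

lemma avd_union (H : Finset (Finset α)) (X Y : Finset α) (S : Finset (Finset α)) (hS : S ⊆ H) :
    avd H (X ∪ Y) S = avd H X S * avd H Y S := by
  simp only [avd_eq _ _ _ hS, Finset.disjoint_union_right, ite_mul, one_mul, zero_mul]
  by_cases h1 : ∀ g ∈ S, Disjoint g X <;> by_cases h2 : ∀ g ∈ S, Disjoint g Y
  · rw [if_pos h1, if_pos h2, if_pos fun g hg => ⟨h1 g hg, h2 g hg⟩]
  · rw [if_pos h1, if_neg h2, if_neg fun h => h2 fun g hg => (h g hg).2]
  · rw [if_neg h1, if_neg fun h => h1 fun g hg => (h g hg).1]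
  · rw [if_neg h1, if_neg fun h => h1 fun g hg => (h g hg).1]

lemma deg_res (H : Finset (Finset α)) (v : α) (S : Finset (Finset α)) (hS : S ⊆ H) :
    deg (res H S) v = ∑ e ∈ inc H v, avd H e S := by
  simp only [avd_eq _ _ _ hS, deg, res, inc]
  rw [Finset.sum_ite, Finset.filter_comm]
  simp

lemma ptwise (H : Finset (Finset α)) (v : α) (S : Finset (Finset α)) (hS : S ⊆ H) (D' : ℝ) :
    (if ∀ e ∈ S, v ∉ e then (deg (res H S) v - D') ^ 2 else 0) =
      (∑ e ∈ inc H v, ∑ f ∈ inc H v, avd H (e ∪ f) S) - 2 * D' * (∑ e ∈ inc H v, avd H e S)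
        + D' ^ 2 * avd H {v} S := by
  have h1 : (∑ e ∈ inc H v, ∑ f ∈ inc H v, avd H (e ∪ f) S) = (deg (res H S) v) ^ 2 := by
    rw [deg_res _ _ _ hS, sq, Finset.sum_mul_sum]
    simp only [avd_union _ _ _ _ hS]
  have h2 : avd H {v} S = if ∀ e ∈ S, v ∉ e then 1 else 0 := by
    rw [avd_eq _ _ _ hS]; simp
  rw [h1, ← deg_res _ _ _ hS, h2]
  split_ifs with h
  · ring
  · have : deg (res H S) v = 0 := by
      push Not at h
      obtain ⟨g, hg, hvg⟩ := h
      simp only [deg, res, Nat.cast_eq_zero, Finset.card_eq_zero]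
      ext e
      simp only [Finset.mem_filter, Finset.notMem_empty, iff_false, not_and]
      intro h1 h2
      exact Finset.disjoint_left.1 (h1.2 g hg) hvg h2
    rw [this]; ring

lemma expL {x y z : ℝ} (hx : 0 ≤ x) (hz : 0 ≤ z) (h : y - x ≤ z) :
    Real.exp (-x) ≤ Real.exp (-y) + z := by
  have h1 : Real.exp (-y) = Real.exp (-x) * Real.exp (-(y - x)) := by
    rw [← Real.exp_add]; ring_nf
  have h2 : -(y - x) + 1 ≤ Real.exp (-(y - x)) := Real.add_one_le_exp _
  have h3 : Real.exp (-x) ≤ 1 := Real.exp_le_one_iff.2 (by linarith)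
  have h4 : 0 < Real.exp (-x) := Real.exp_pos _
  rw [h1]
  nlinarith

lemma touch_upper (H : Finset (Finset α)) (X : Finset α) :
    ((touch H X).card : ℝ) ≤ ∑ x ∈ X, deg H x := by
  have h : touch H X ⊆ X.biUnion (fun x => H.filter (fun e => x ∈ e)) := by
    intro g hg
    simp only [touch, Finset.mem_filter, Finset.not_disjoint_iff] at hg
    obtain ⟨h1, x, h2, h3⟩ := hg
    simp only [Finset.mem_biUnion, Finset.mem_filter]
    exact ⟨x, h3, h1, h2⟩
  have h2 := (Finset.card_le_card h).trans Finset.card_biUnion_le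
  unfold deg
  exact_mod_cast h2

lemma deg_eq_sum (H : Finset (Finset α)) (x : α) :
    deg H x = ∑ g ∈ H, if x ∈ g then (1:ℝ) else 0 := by
  simp [deg]

lemma cod_eq_sum (H : Finset (Finset α)) (x y : α) :
    cod H x y = ∑ g ∈ H, if x ∈ g ∧ y ∈ g then (1:ℝ) else 0 := by
  simp [cod]

lemma touch_lower (H : Finset (Finset α)) (X : Finset α) :
    ∑ x ∈ X, deg H x - ∑ z ∈ X.offDiag, cod H z.1 z.2 ≤ ((touch H X).card : ℝ) := by
  simp only [deg_eq_sum, cod_eq_sum]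
  rw [Finset.sum_comm, Finset.sum_comm (s := X.offDiag), ← Finset.sum_sub_distrib]
  have : ((touch H X).card : ℝ) = ∑ g ∈ H, if ¬ Disjoint g X then (1:ℝ) else 0 := by
    rw [touch, Finset.sum_boole]
  rw [this]
  refine Finset.sum_le_sum fun g _ => ?_
  have h1 : (∑ x ∈ X, if x ∈ g then (1:ℝ) else 0) = (X ∩ g).card := by
    rw [Finset.sum_boole, Finset.filter_mem_eq_inter]
  have h2 : (∑ z ∈ X.offDiag, if z.1 ∈ g ∧ z.2 ∈ g then (1:ℝ) else 0) = (X ∩ g).offDiag.card := by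
    rw [Finset.sum_boole]
    congr 2
    ext z
    simp only [Finset.mem_filter, Finset.mem_offDiag, Finset.mem_inter]
    tauto
  rw [h1, h2, Finset.offDiag_card]
  by_cases h : Disjoint g X
  · have : X ∩ g = ∅ := Finset.disjoint_iff_inter_eq_empty.1 h.symm
    simp only [this]
    split_ifs
    simp
  · rw [if_pos h]
    generalize (X ∩ g).card = m
    have h3 : m ≤ 1 + (m * m - m) := by
      rcases m with _ | _ | m
      · simp
      · simp
      · have : (m + 1 + 1) * (m + 1 + 1) = (m+2) + ((m+2) * (m+1)) := by ring
        rw [this, show m + 1 + 1 = m + 2 from rfl, Nat.add_sub_cancel_left]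
        nlinarith
    have h4 : (m : ℝ) ≤ 1 + ((m * m - m : ℕ) : ℝ) := by exact_mod_cast h3
    linarith

/-- total deviation of the degrees on an edge -/
noncomputable def dev (H : Finset (Finset α)) (D : ℝ) (e : Finset α) : ℝ :=
  ∑ x ∈ e, |deg H x - D|

lemma dev_nonneg (H : Finset (Finset α)) (D : ℝ) (e : Finset α) : 0 ≤ dev H D e :=
  Finset.sum_nonneg fun _ _ => abs_nonneg _

lemma exp_pow (ε D : ℝ) (m : ℕ) :
    Real.exp (-(ε / D)) ^ m = Real.exp (-(ε * m / D)) := by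
  rw [← Real.exp_nat_mul]; congr 1; ring

lemma term_a (k : ℕ) (ε D γ : ℝ) (hε : 0 ≤ ε) (hD : 0 < D) (hγ : 0 ≤ γ)
    (H : Finset (Finset α)) (hU : ∀ e ∈ H, e.card = k)
    (hc : ∀ x y, x ≠ y → cod H x y ≤ γ * D) (v : α) (e f : Finset α) (he : e ∈ H) (hf : f ∈ H)
    (hve : v ∈ e) (hvf : v ∈ f) :
    Ex H (Real.exp (-(ε / D))) (avd H (e ∪ f)) ≤ Real.exp (-(ε * (2 * k - 1))) +
      ε * ((dev H D e + dev H D f) / D + 4 * k ^ 2 * γ + (((e ∩ f).card : ℝ) - 1)) := by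
  rw [Ex_avd, exp_pow]
  have h1 := touch_lower H (e ∪ f)
  have hcard : ((e ∪ f).card : ℝ) + (e ∩ f).card = 2 * k := by
    have := Finset.card_union_add_card_inter e f
    rw [hU e he, hU f hf] at this
    have h2 : (((e ∪ f).card + (e ∩ f).card : ℕ) : ℝ) = ((k + k : ℕ) : ℝ) := by rw [this]
    push_cast at h2
    linarith
  have hint : (1:ℝ) ≤ (e ∩ f).card := by
    have : 0 < (e ∩ f).card := Finset.card_pos.2 ⟨v, Finset.mem_inter.2 ⟨hve, hvf⟩⟩
    exact_mod_cast this
  have hoff : ∑ z ∈ (e ∪ f).offDiag, cod H z.1 z.2 ≤ 4 * k ^ 2 * γ * D := by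
    calc ∑ z ∈ (e ∪ f).offDiag, cod H z.1 z.2 ≤ ∑ z ∈ (e ∪ f).offDiag, γ * D :=
          Finset.sum_le_sum fun z hz => hc _ _ (Finset.mem_offDiag.1 hz).2.2
      _ = ((e ∪ f).offDiag.card : ℝ) * (γ * D) := by rw [Finset.sum_const, nsmul_eq_mul]
      _ ≤ (4 * k ^ 2) * (γ * D) := by
          apply mul_le_mul_of_nonneg_right _ (by positivity)
          rw [Finset.offDiag_card]
          have h3 : (e ∪ f).card ≤ 2 * k := by
            have := Finset.card_union_le e f
            rw [hU e he, hU f hf] at this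
            omega
          have h4 : (e ∪ f).card * (e ∪ f).card - (e ∪ f).card ≤ 4 * k ^ 2 := by
            have := Nat.mul_le_mul h3 h3
            have h5 : 2 * k * (2 * k) = 4 * k ^ 2 := by ring
            omega
          exact_mod_cast h4
      _ = _ := by ring
  have hdeg : ((e ∪ f).card : ℝ) * D - (dev H D e + dev H D f) ≤ ∑ x ∈ e ∪ f, deg H x := by
    have h3 : dev H D (e ∪ f) ≤ dev H D e + dev H D f := by
      unfold dev
      rw [← Finset.sum_union_inter]
      have : 0 ≤ ∑ x ∈ e ∩ f, |deg H x - D| := Finset.sum_nonneg fun _ _ => abs_nonneg _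
      linarith
    have h4 : ((e ∪ f).card : ℝ) * D = ∑ x ∈ e ∪ f, D := by rw [Finset.sum_const, nsmul_eq_mul]
    have h5 : ∑ x ∈ e ∪ f, D - dev H D (e ∪ f) ≤ ∑ x ∈ e ∪ f, deg H x := by
      unfold dev
      rw [← Finset.sum_sub_distrib]
      refine Finset.sum_le_sum fun x _ => ?_
      have := neg_abs_le (deg H x - D)
      linarith
    linarith
  have hde := dev_nonneg H D e
  have hdf := dev_nonneg H D f
  apply expL
  · positivity
  · apply mul_nonneg hε
    have : 0 ≤ (dev H D e + dev H D f) / D + 4 * k ^ 2 * γ := by positivity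
    linarith
  · have h6 : (2 * (k:ℝ) - (e ∩ f).card) * D - (dev H D e + dev H D f) - 4 * k ^ 2 * γ * D ≤
      (touch H (e ∪ f)).card := by
      have : ((e ∪ f).card : ℝ) = 2 * k - (e ∩ f).card := by linarith
      rw [this] at hdeg
      linarith
    have h7 : (2 * (k:ℝ) - (e ∩ f).card) - (dev H D e + dev H D f) / D - 4 * k ^ 2 * γ ≤
      (touch H (e ∪ f)).card / D := by
      rw [le_div_iff₀ hD]
      calc _ = _ := by field_simp
        _ ≤ _ := h6
    have h8 := mul_le_mul_of_nonneg_left h7 hε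
    rw [mul_div_assoc]
    linarith

lemma term_b (k : ℕ) (ε D : ℝ) (hε : 0 ≤ ε) (hD : 0 < D)
    (H : Finset (Finset α)) (e : Finset α) (he : e.card = k) :
    Real.exp (-(ε * k)) ≤ Ex H (Real.exp (-(ε / D))) (avd H e) + ε * (dev H D e / D) := by
  rw [Ex_avd, exp_pow]
  have hde := dev_nonneg H D e
  apply expL (by positivity) (by positivity)
  have h1 := touch_upper H e
  have h2 : ∑ x ∈ e, deg H x ≤ k * D + dev H D e := by
    unfold dev
    rw [← he, ← nsmul_eq_mul, ← Finset.sum_const, ← Finset.sum_add_distrib]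
    refine Finset.sum_le_sum fun x _ => ?_
    have := le_abs_self (deg H x - D)
    linarith
  have h3 : ((touch H e).card : ℝ) / D ≤ k + dev H D e / D := by
    rw [div_le_iff₀ hD]
    calc _ ≤ _ := h1.trans h2
      _ = _ := by field_simp
  have h8 := mul_le_mul_of_nonneg_left h3 hε
  rw [mul_div_assoc]
  linarith

lemma touch_single (H : Finset (Finset α)) (v : α) : ((touch H {v}).card : ℝ) = deg H v := by
  simp [touch, deg]

lemma term_c (ε D : ℝ) (hε : 0 ≤ ε) (hD : 0 < D)
    (H : Finset (Finset α)) (v : α) :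
    Ex H (Real.exp (-(ε / D))) (avd H {v}) ≤ Real.exp (-ε) + ε * (|deg H v - D| / D) := by
  rw [Ex_avd, exp_pow, touch_single]
  have h0 : 0 ≤ deg H v := by unfold deg; positivity
  apply expL (by positivity) (by positivity)
  have h3 : 1 - deg H v / D ≤ |deg H v - D| / D := by
    rw [le_div_iff₀ hD]
    have : (1 - deg H v / D) * D = D - deg H v := by field_simp
    rw [this, abs_sub_comm]
    exact le_abs_self _
  have h8 := mul_le_mul_of_nonneg_left h3 hε
  rw [mul_div_assoc]
  linarith

lemma sum_inter (k : ℕ) (D γ : ℝ) (hD : 0 < D) (hγ : 0 ≤ γ)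
    (H : Finset (Finset α)) (hc : ∀ x y, x ≠ y → cod H x y ≤ γ * D) (v : α) (e : Finset α)
    (he : e.card = k) (hve : v ∈ e) :
    ∑ f ∈ inc H v, (((e ∩ f).card : ℝ) - 1) ≤ k * γ * D := by
  have h1 : ∀ f ∈ inc H v, (((e ∩ f).card : ℝ) - 1) =
      ∑ y ∈ e.erase v, if y ∈ f then (1:ℝ) else 0 := by
    intro f hf
    have hvf : v ∈ f := (Finset.mem_filter.1 hf).2
    have h2 : (e.erase v).filter (fun y => y ∈ f) = (e ∩ f).erase v := by
      ext y
      simp only [Finset.mem_filter, Finset.mem_erase, Finset.mem_inter]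
      tauto
    rw [Finset.sum_boole, h2]
    have h3 := Finset.card_erase_add_one (Finset.mem_inter.2 ⟨hve, hvf⟩)
    rw [← h3]
    push_cast
    ring
  rw [Finset.sum_congr rfl h1, Finset.sum_comm]
  calc _ ≤ ∑ y ∈ e.erase v, γ * D := by
        refine Finset.sum_le_sum fun y hy => ?_
        refine le_trans (le_of_eq ?_) (hc v y (Finset.ne_of_mem_erase hy).symm)
        rw [Finset.sum_boole, inc, Finset.filter_filter, cod]
    _ = ((e.erase v).card : ℝ) * (γ * D) := by rw [Finset.sum_const, nsmul_eq_mul]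
    _ ≤ k * (γ * D) := by
        apply mul_le_mul_of_nonneg_right _ (by positivity)
        rw [← he]
        exact_mod_cast Finset.card_le_card (Finset.erase_subset _ _)
    _ = _ := by ring

/-- sum of deviations over edges at `v` -/
noncomputable def sdev (H : Finset (Finset α)) (D : ℝ) (v : α) : ℝ := ∑ e ∈ inc H v, dev H D e

lemma vertex_bound (k : ℕ) (ε D γ r : ℝ) (hε : 0 ≤ ε) (hD : 0 < D) (hγ : 0 ≤ γ) (_hr : 0 ≤ r)
    (H : Finset (Finset α)) (hU : ∀ e ∈ H, e.card = k) (hk : 1 ≤ k)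
    (hd : ∀ x, deg H x ≤ r * D)
    (hc : ∀ x y, x ≠ y → cod H x y ≤ γ * D) (v : α) :
    Ex H (Real.exp (-(ε / D))) (fun S => if ∀ e ∈ S, v ∉ e then
        (deg (res H S) v - D * Real.exp (-(ε * (k - 1)))) ^ 2 else 0) ≤
      (deg H v - D) ^ 2 + ε * ((2 * r + 2) * sdev H D v + (4 * k ^ 2 * r ^ 2 + k * r) * γ * D ^ 2
        + D * |deg H v - D|) := by
  set D' := D * Real.exp (-(ε * (k - 1))) with hD'
  have hk' : (1:ℝ) ≤ k := by exact_mod_cast hk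
  have hd0 : 0 ≤ deg H v := by unfold deg; positivity
  have hdv := hd v
  have hs0 : 0 ≤ sdev H D v := Finset.sum_nonneg fun _ _ => dev_nonneg _ _ _
  have hinc : ((inc H v).card : ℝ) = deg H v := rfl
  have hmem : ∀ e ∈ inc H v, e ∈ H ∧ v ∈ e := fun e he => Finset.mem_filter.1 he
  rw [Ex_congr _ _ _ _ (fun S hS => ptwise H v S hS D'), Ex_add, Ex_sub, Ex_smul, Ex_smul, Ex_sum,
    Ex_sum]
  simp only [Ex_sum]
  have hD'0 : 0 ≤ D' := by positivity
  have hD'D : D' ≤ D := by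
    have : Real.exp (-(ε * (k - 1))) ≤ 1 := Real.exp_le_one_iff.2 (by nlinarith)
    nlinarith
  set q := Real.exp (-(ε / D)) with hq
  have ha : ∑ e ∈ inc H v, ∑ f ∈ inc H v, Ex H q (avd H (e ∪ f)) ≤
      deg H v ^ 2 * Real.exp (-(ε * (2 * k - 1))) + ε * (2 * deg H v * sdev H D v / D +
        deg H v ^ 2 * (4 * k ^ 2 * γ) + deg H v * (k * γ * D)) := by
    have h1 : ∀ e ∈ inc H v, ∑ f ∈ inc H v, Ex H q (avd H (e ∪ f)) ≤
        deg H v * Real.exp (-(ε * (2 * k - 1))) + ε * ((deg H v * dev H D e + sdev H D v) / D +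
          deg H v * (4 * k ^ 2 * γ) + k * γ * D) := by
      intro e he
      calc _ ≤ ∑ f ∈ inc H v, (Real.exp (-(ε * (2 * k - 1))) +
            ε * ((dev H D e + dev H D f) / D + 4 * k ^ 2 * γ + (((e ∩ f).card : ℝ) - 1))) :=
            Finset.sum_le_sum fun f hf => term_a k ε D γ hε hD hγ H hU hc v e f (hmem e he).1
              (hmem f hf).1 (hmem e he).2 (hmem f hf).2
        _ = deg H v * Real.exp (-(ε * (2 * k - 1))) + ε * ((deg H v * dev H D e + sdev H D v) / D +
          deg H v * (4 * k ^ 2 * γ) + ∑ f ∈ inc H v, (((e ∩ f).card : ℝ) - 1)) := by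
            rw [Finset.sum_add_distrib, ← Finset.mul_sum, Finset.sum_add_distrib,
              Finset.sum_add_distrib, ← Finset.sum_div, Finset.sum_add_distrib]
            simp only [Finset.sum_const, nsmul_eq_mul, hinc, sdev]
        _ ≤ _ := by
            have := sum_inter k D γ hD hγ H hc v e (hU e (hmem e he).1) (hmem e he).2
            gcongr
    refine (Finset.sum_le_sum h1).trans (le_of_eq ?_)
    simp only [Finset.sum_add_distrib, ← Finset.mul_sum, ← Finset.sum_div]
    simp only [Finset.sum_const, nsmul_eq_mul, hinc]
    rw [← sdev]
    ring
  have hb : deg H v * Real.exp (-(ε * k)) - ε * (sdev H D v / D) ≤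
      ∑ e ∈ inc H v, Ex H q (avd H e) := by
    have h1 := Finset.sum_le_sum (fun e (he : e ∈ inc H v) =>
      term_b k ε D hε hD H e (hU e (hmem e he).1))
    rw [Finset.sum_add_distrib, ← Finset.mul_sum, ← Finset.sum_div, Finset.sum_const,
      nsmul_eq_mul, hinc, ← sdev] at h1
    linarith
  have hcc := term_c ε D hε hD H v
  have hb' := mul_le_mul_of_nonneg_left hb (by positivity : 0 ≤ 2 * D')
  have hc' := mul_le_mul_of_nonneg_left hcc (by positivity : 0 ≤ D' ^ 2)
  set E2 := Real.exp (-(ε * (2 * k - 1))) with hE2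
  have e1 : D' * Real.exp (-(ε * k)) = D * E2 := by
    rw [hD', hE2, mul_assoc, ← Real.exp_add]; ring_nf
  have e2 : D' ^ 2 * Real.exp (-ε) = D ^ 2 * E2 := by
    rw [hD', hE2, mul_pow, mul_assoc, ← Real.exp_nat_mul, ← Real.exp_add]
    congr 2; push_cast; ring
  have hE21 : E2 ≤ 1 := Real.exp_le_one_iff.2 (by nlinarith)
  have hmain : E2 * (deg H v - D) ^ 2 ≤ (deg H v - D) ^ 2 := by
    nlinarith [sq_nonneg (deg H v - D)]
  have f1 : 2 * deg H v * sdev H D v / D ≤ 2 * r * sdev H D v := by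
    rw [div_le_iff₀ hD]
    nlinarith
  have f2 : deg H v ^ 2 * (4 * k ^ 2 * γ) ≤ (r * D) ^ 2 * (4 * k ^ 2 * γ) := by gcongr
  have f3 : deg H v * (k * γ * D) ≤ (r * D) * (k * γ * D) := by gcongr
  have f4 : D' * (sdev H D v / D) ≤ sdev H D v := by
    calc _ ≤ D * (sdev H D v / D) := by gcongr
      _ = _ := by field_simp
  have f5 : D' ^ 2 * (|deg H v - D| / D) ≤ D * |deg H v - D| := by
    calc _ ≤ D ^ 2 * (|deg H v - D| / D) := by gcongr
      _ = _ := by field_simp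
  have g1 := mul_le_mul_of_nonneg_left f1 hε
  have g2 := mul_le_mul_of_nonneg_left f2 hε
  have g3 := mul_le_mul_of_nonneg_left f3 hε
  have g4 := mul_le_mul_of_nonneg_left f4 hε
  have g5 := mul_le_mul_of_nonneg_left f5 hε
  have e1' : 2 * D' * (deg H v * Real.exp (-(ε * k)) - ε * (sdev H D v / D)) =
    2 * deg H v * (D * E2) - 2 * (ε * (D' * (sdev H D v / D))) := by rw [← e1]; ring
  have e2' : D' ^ 2 * (Real.exp (-ε) + ε * (|deg H v - D| / D)) =
    D ^ 2 * E2 + ε * (D' ^ 2 * (|deg H v - D| / D)) := by rw [← e2]; ring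
  rw [e1'] at hb'
  rw [e2'] at hc'
  linarith


lemma sum_inc (V : Finset α) (H : Finset (Finset α)) (hV : ∀ e ∈ H, e ⊆ V)
    (g : α → Finset α → ℝ) :
    ∑ v ∈ V, ∑ e ∈ inc H v, g v e = ∑ e ∈ H, ∑ v ∈ e, g v e := by
  apply Finset.sum_comm'
  intro x y
  simp only [inc, Finset.mem_filter]
  exact ⟨fun h => ⟨h.2.2, h.2.1⟩, fun h => ⟨hV y h.2 h.1, h.2, h.1⟩⟩

lemma sum_sdev (k : ℕ) (D r : ℝ) (V : Finset α) (H : Finset (Finset α))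
    (hU : ∀ e ∈ H, e.card = k) (hV : ∀ e ∈ H, e ⊆ V) (hd : ∀ x, deg H x ≤ r * D) :
    ∑ v ∈ V, sdev H D v ≤ k * r * D * ∑ x ∈ V, |deg H x - D| := by
  unfold sdev
  rw [sum_inc V H hV (fun _ e => dev H D e)]
  have h1 : ∑ e ∈ H, ∑ _v ∈ e, dev H D e = k * ∑ e ∈ H, ∑ x ∈ e, |deg H x - D| := by
    rw [Finset.mul_sum]
    refine Finset.sum_congr rfl fun e he => ?_
    rw [Finset.sum_const, nsmul_eq_mul, hU e he, dev]
  rw [h1, ← sum_inc V H hV (fun x _ => |deg H x - D|), mul_assoc, mul_assoc, ← mul_assoc r]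
  apply mul_le_mul_of_nonneg_left _ (by positivity)
  rw [Finset.mul_sum]
  refine Finset.sum_le_sum fun x _ => ?_
  rw [Finset.sum_const, nsmul_eq_mul]
  exact mul_le_mul_of_nonneg_right (hd x) (abs_nonneg _)

/-- total squared deviation -/
noncomputable def pot (V : Finset α) (H : Finset (Finset α)) (D : ℝ) : ℝ :=
  ∑ x ∈ V, (deg H x - D) ^ 2

lemma pot_bound (k : ℕ) (ε D γ r : ℝ) (hε : 0 ≤ ε) (hD : 0 < D) (hγ : 0 ≤ γ) (hr : 0 ≤ r)
    (V : Finset α) (H : Finset (Finset α)) (hU : ∀ e ∈ H, e.card = k) (hk : 1 ≤ k)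
    (hV : ∀ e ∈ H, e ⊆ V) (hd : ∀ x, deg H x ≤ r * D)
    (hc : ∀ x y, x ≠ y → cod H x y ≤ γ * D) :
    Ex H (Real.exp (-(ε / D)))
      (fun S => pot (surv V S) (res H S) (D * Real.exp (-(ε * (k - 1))))) ≤
      pot V H D + ε * ((2 * r + 2) * (k * r) + 1) * D * (∑ x ∈ V, |deg H x - D|)
        + ε * (4 * k ^ 2 * r ^ 2 + k * r) * γ * D ^ 2 * V.card := by
  have h1 : ∀ S : Finset (Finset α),
      pot (surv V S) (res H S) (D * Real.exp (-(ε * (k - 1)))) =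
      ∑ v ∈ V, if ∀ e ∈ S, v ∉ e then
        (deg (res H S) v - D * Real.exp (-(ε * (k - 1)))) ^ 2 else 0 := by
    intro S
    rw [pot, surv, Finset.sum_filter]
  rw [Ex_congr _ _ _ _ (fun S _ => h1 S), Ex_sum]
  refine (Finset.sum_le_sum fun v _ =>
    vertex_bound k ε D γ r hε hD hγ hr H hU hk hd hc v).trans ?_
  simp only [Finset.sum_add_distrib, ← Finset.mul_sum, Finset.sum_const, nsmul_eq_mul]
  have h2 := sum_sdev k D r V H hU hV hd
  have h3 := mul_le_mul_of_nonneg_left h2 (by positivity : 0 ≤ ε * (2 * r + 2))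
  rw [pot]
  linarith

lemma card_bound (k : ℕ) (ε D : ℝ) (hε : 0 ≤ ε) (hD : 0 < D)
    (V : Finset α) (H : Finset (Finset α)) (hU : ∀ e ∈ H, e.card = k) (hk : 1 ≤ k)
    (hV : ∀ e ∈ H, e ⊆ V) :
    Ex H (Real.exp (-(ε / D))) (fun S => (S.card : ℝ)) ≤
      ε / k * V.card + ε / k * ((∑ x ∈ V, |deg H x - D|) / D) := by
  have hk' : (0:ℝ) < k := by exact_mod_cast hk
  rw [Ex_card]
  have h1 : 1 - Real.exp (-(ε / D)) ≤ ε / D := by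
    have := Real.add_one_le_exp (-(ε / D))
    linarith
  have h2 : (k:ℝ) * H.card ≤ D * V.card + ∑ x ∈ V, |deg H x - D| := by
    have h3 := sum_inc V H hV (fun _ _ => (1:ℝ))
    have h4 : ∑ e ∈ H, ∑ _v ∈ e, (1:ℝ) = k * H.card := by
      rw [Finset.sum_congr rfl (g := fun _ => (k:ℝ))]
      · rw [Finset.sum_const, nsmul_eq_mul, mul_comm]
      · intro e he
        rw [Finset.sum_const, nsmul_eq_mul, hU e he, mul_one]
    rw [← h4, ← h3, mul_comm D, ← nsmul_eq_mul, ← Finset.sum_const, ← Finset.sum_add_distrib]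
    refine Finset.sum_le_sum fun x _ => ?_
    rw [Finset.sum_const, nsmul_eq_mul, mul_one]
    have := le_abs_self (deg H x - D)
    have h5 : ((inc H x).card : ℝ) = deg H x := rfl
    linarith
  calc (H.card : ℝ) * (1 - Real.exp (-(ε / D))) ≤ H.card * (ε / D) := by gcongr
    _ = (k * H.card) * (ε / (k * D)) := by field_simp
    _ ≤ (D * V.card + ∑ x ∈ V, |deg H x - D|) * (ε / (k * D)) := by gcongr
    _ = _ := by field_simp

lemma surv_bound (ε D : ℝ) (hε : 0 ≤ ε) (hD : 0 < D)
    (V : Finset α) (H : Finset (Finset α)) :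
    Ex H (Real.exp (-(ε / D))) (fun S => ((surv V S).card : ℝ)) ≤
      Real.exp (-ε) * V.card + ε * ((∑ x ∈ V, |deg H x - D|) / D) := by
  have h1 : ∀ S ⊆ H, ((surv V S).card : ℝ) = ∑ v ∈ V, avd H {v} S := by
    intro S hS
    simp only [avd_eq _ _ _ hS, Finset.disjoint_singleton_right]
    rw [Finset.sum_boole, surv]
  rw [Ex_congr _ _ _ _ h1, Ex_sum]
  refine (Finset.sum_le_sum fun v _ => term_c ε D hε hD H v).trans (le_of_eq ?_)
  rw [Finset.sum_add_distrib, Finset.sum_const, nsmul_eq_mul, ← Finset.mul_sum, ← Finset.sum_div]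
  ring

lemma dev_le (V : Finset α) (H : Finset (Finset α)) (D N δ : ℝ) (hD : 0 < D) (hδ : 0 ≤ δ)
    (hN : (V.card : ℝ) ≤ N) (hp : pot V H D ≤ δ ^ 2 * N * D ^ 2) :
    ∑ x ∈ V, |deg H x - D| ≤ δ * N * D := by
  have h0 : (0:ℝ) ≤ V.card := by positivity
  have hN0 : 0 ≤ N := h0.trans hN
  have h1 := sq_sum_le_card_mul_sum_sq (s := V) (f := fun x => |deg H x - D|)
  simp only [sq_abs] at h1
  rw [← pot] at h1
  apply le_of_sq_le_sq _ (by positivity)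
  have hp0 : 0 ≤ pot V H D := Finset.sum_nonneg fun _ _ => sq_nonneg _
  calc _ ≤ _ := h1
    _ ≤ N * (δ ^ 2 * N * D ^ 2) := by gcongr
    _ = _ := by ring

/-- cost recursion -/
noncomputable def cst (k : ℕ) (ε : ℝ) : ℕ → ℝ
  | 0 => 1
  | t + 1 => ε / k + Real.exp (-ε) * cst k ε t

lemma cst_nonneg (k : ℕ) (ε : ℝ) (hε : 0 ≤ ε) (t : ℕ) : 0 ≤ cst k ε t := by
  induction t with
  | zero => simp [cst]
  | succ t ih => simp only [cst]; positivity

lemma res_subset (H S : Finset (Finset α)) : res H S ⊆ H := Finset.filter_subset _ _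

lemma surv_subset (V : Finset α) (S : Finset (Finset α)) : surv V S ⊆ V :=
  Finset.filter_subset _ _

lemma res_sub_surv (V : Finset α) (H S : Finset (Finset α)) (hV : ∀ e ∈ H, e ⊆ V) :
    ∀ e ∈ res H S, e ⊆ surv V S := by
  intro e he x hx
  have he' := Finset.mem_filter.1 he
  refine Finset.mem_filter.2 ⟨hV e he'.1 hx, fun g hg hxg => ?_⟩
  exact Finset.disjoint_left.1 (he'.2 g hg) hxg hx

lemma surv_union (V : Finset α) (S C : Finset (Finset α)) :
    surv V (S ∪ C) = surv (surv V S) C := by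
  ext x
  simp only [surv, Finset.mem_filter, Finset.mem_union, or_imp, forall_and]
  tauto

set_option maxHeartbeats 1000000 in
lemma nibble (k : ℕ) (hk : 1 ≤ k) (ε : ℝ) (hε : 0 < ε) (t : ℕ) : ∀ (r η : ℝ), 0 ≤ r → 0 < η →
    ∃ δ : ℝ, 0 < δ ∧ ∀ (n : ℕ) (V : Finset (Fin n)) (H : Finset (Finset (Fin n))) (D N : ℝ), 0 < D →
      (V.card : ℝ) ≤ N → (∀ e ∈ H, e.card = k) → (∀ e ∈ H, e ⊆ V) → (∀ x, deg H x ≤ r * D) →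
      (∀ x y, x ≠ y → cod H x y ≤ δ * D) → pot V H D ≤ δ ^ 2 * N * D ^ 2 →
      ∃ C ⊆ H, (C.card : ℝ) + (surv V C).card ≤ cst k ε t * V.card + η * N := by
  induction t with
  | zero =>
    intro r η hr hη
    refine ⟨1, one_pos, ?_⟩
    intro n V H D N hD hN _ _ _ _ _
    refine ⟨∅, by simp, ?_⟩
    have h0 : (0:ℝ) ≤ V.card := by positivity
    have hN0 : 0 ≤ N := h0.trans hN
    simp only [surv, cst, Finset.card_empty, Finset.notMem_empty]
    simp
    positivity
  | succ t ih =>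
    intro r η hr hη
    have hk' : (1:ℝ) ≤ k := by exact_mod_cast hk
    set w := Real.exp (-(ε * (k - 1))) with hw
    have hw0 : 0 < w := Real.exp_pos _
    obtain ⟨δ', hδ', IH⟩ := ih (r / w) (η / 2) (by positivity) (by positivity)
    have hct := cst_nonneg k ε hε.le t
    have hct1 := cst_nonneg k ε hε.le (t + 1)
    set B := cst k ε (t + 1) + η / 2 with hB
    have hB0 : 0 < B := by positivity
    set m := B / (δ' ^ 2 * w ^ 2) with hm
    have hm0 : 0 < m := by positivity
    set K := ε * ((2 * r + 2) * (k * r) + 1) + ε * (4 * k ^ 2 * r ^ 2 + k * r) with hK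
    have hK0 : 0 ≤ K := by positivity
    set Q := ε / k + cst k ε t * ε + m * (1 + K) with hQ
    have hQ0 : 0 < Q := by positivity
    set δ := min 1 (min (δ' * w) (η / 2 / Q)) with hδ
    have hδ0 : 0 < δ := by positivity
    have hδ1 : δ ≤ 1 := min_le_left _ _
    have hδ2 : δ ≤ δ' * w := (min_le_right _ _).trans (min_le_left _ _)
    have hδ3 : δ * Q ≤ η / 2 := by
      rw [← le_div_iff₀ hQ0]; exact (min_le_right _ _).trans (min_le_right _ _)
    refine ⟨δ, hδ0, ?_⟩
    intro n V H D N hD hN hU hV hd hc hp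
    have h0 : (0:ℝ) ≤ V.card := by positivity
    have hN0 : 0 ≤ N := h0.trans hN
    have hUd := dev_le V H D N δ hD hδ0.le hN hp
    set Ud := ∑ x ∈ V, |deg H x - D| with hUdd
    have b1 := card_bound k ε D hε.le hD V H hU hk hV
    have b2 := surv_bound ε D hε.le hD V H
    have b3 := pot_bound k ε D δ r hε.le hD hδ0.le hr V H hU hk hV hd hc
    rw [← hUdd] at b1 b2 b3
    rw [← hw] at b3
    have hUD : Ud / D ≤ δ * N := by rw [div_le_iff₀ hD]; exact hUd
    have hq1 : Real.exp (-(ε / D)) ≤ 1 :=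
      Real.exp_le_one_iff.2 (by have : 0 < ε / D := by positivity
                                linarith)
    obtain ⟨S, hS, hX⟩ := exists_le_Ex H (Real.exp (-(ε / D))) (Real.exp_pos _).le hq1
      (fun S => (S.card : ℝ) + cst k ε t * (surv V S).card
        + m / D ^ 2 * pot (surv V S) (res H S) (D * w))
    rw [Ex_add, Ex_add, Ex_smul, Ex_smul] at hX
    have b3' : m / D ^ 2 * Ex H (Real.exp (-(ε / D)))
        (fun S => pot (surv V S) (res H S) (D * w)) ≤ m * (1 + K) * (δ * N) := by
      have : Ex H (Real.exp (-(ε / D))) (fun S => pot (surv V S) (res H S) (D * w)) ≤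
          (1 + K) * (δ * N) * D ^ 2 := by
        have c1 : pot V H D ≤ δ * N * D ^ 2 := by
          refine hp.trans ?_
          gcongr
          nlinarith
        have c2 : ε * ((2 * r + 2) * (k * r) + 1) * D * Ud ≤
          ε * ((2 * r + 2) * (k * r) + 1) * D * (δ * N * D) := by gcongr
        have c3 : ε * (4 * k ^ 2 * r ^ 2 + k * r) * δ * D ^ 2 * V.card ≤
          ε * (4 * k ^ 2 * r ^ 2 + k * r) * δ * D ^ 2 * N := by gcongr
        rw [hK]
        linarith
      calc _ ≤ m / D ^ 2 * ((1 + K) * (δ * N) * D ^ 2) := by gcongr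
        _ = _ := by field_simp
    have b1' : ε / k * (Ud / D) ≤ ε / k * (δ * N) := by gcongr
    have b2' : cst k ε t * Ex H (Real.exp (-(ε / D))) (fun S => ((surv V S).card : ℝ)) ≤
        cst k ε t * (Real.exp (-ε) * V.card + ε * (δ * N)) := by
      apply mul_le_mul_of_nonneg_left _ hct
      refine b2.trans ?_
      gcongr
    have hX2 : (S.card : ℝ) + cst k ε t * (surv V S).card
        + m / D ^ 2 * pot (surv V S) (res H S) (D * w) ≤
        cst k ε (t + 1) * V.card + η / 2 * N := by
      have : δ * Q * N ≤ η / 2 * N := by gcongr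
      rw [hQ] at this
      simp only [cst]
      linarith
    have hpn : 0 ≤ pot (surv V S) (res H S) (D * w) :=
      Finset.sum_nonneg fun _ _ => sq_nonneg _
    have hcs : 0 ≤ cst k ε t * (surv V S).card := by positivity
    have hSn : (0:ℝ) ≤ S.card := by positivity
    have hresH : res H S ⊆ H := res_subset _ _
    have hsV : surv V S ⊆ V := surv_subset _ _
    obtain ⟨C, hC, hCc⟩ := IH n (surv V S) (res H S) (D * w) N (by positivity)
      ((by exact_mod_cast Finset.card_le_card hsV : ((surv V S).card : ℝ) ≤ V.card).trans hN)
      (fun e he => hU e (hresH he))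
      (res_sub_surv V H S hV)
      (by
        intro x
        have : r / w * (D * w) = r * D := by field_simp
        rw [this]
        refine le_trans ?_ (hd x)
        unfold deg
        exact_mod_cast Finset.card_le_card (Finset.filter_subset_filter _ hresH))
      (by
        intro x y hxy
        have h1 : cod (res H S) x y ≤ cod H x y := by
          unfold cod
          exact_mod_cast Finset.card_le_card (Finset.filter_subset_filter _ hresH)
        refine h1.trans ((hc x y hxy).trans ?_)
        nlinarith)
      (by
        have h1 : m / D ^ 2 * pot (surv V S) (res H S) (D * w) ≤ B * N := by
          have : cst k ε (t + 1) * V.card ≤ cst k ε (t + 1) * N := by gcongr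
          rw [hB]
          linarith
        have h2 : m / D ^ 2 * (δ' ^ 2 * N * (D * w) ^ 2) = B * N := by
          rw [hm]; field_simp
        rw [← h2] at h1
        exact le_of_mul_le_mul_left h1 (by positivity))
    refine ⟨S ∪ C, Finset.union_subset hS (hC.trans hresH), ?_⟩
    have h1 : ((S ∪ C).card : ℝ) ≤ S.card + C.card := by exact_mod_cast Finset.card_union_le S C
    have h2 : surv V (S ∪ C) = surv (surv V S) C := surv_union _ _ _
    rw [h2]
    have : 0 ≤ m / D ^ 2 * pot (surv V S) (res H S) (D * w) := by positivity
    linarith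

lemma cst_small (k : ℕ) (hk : 1 ≤ k) (b : ℝ) (hb : 0 < b) :
    ∃ ε : ℝ, 0 < ε ∧ ∃ t, cst k ε t ≤ (1 + b) / k := by
  have hk' : (0:ℝ) < k := by exact_mod_cast hk
  refine ⟨b / 2, by positivity, ?_⟩
  set ε := b / 2 with hε
  have hε0 : 0 < ε := by positivity
  set x := Real.exp (-ε) with hx
  have hx0 : 0 < x := Real.exp_pos _
  have hx1 : x < 1 := Real.exp_lt_one_iff.2 (by linarith)
  have hx2 : x * (1 + ε) ≤ 1 := by
    have h1 := Real.add_one_le_exp ε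
    have h2 : x * Real.exp ε = 1 := by rw [hx, ← Real.exp_add]; simp
    nlinarith
  have h : ∀ t, cst k ε t ≤ (1 + ε) / k + x ^ t := by
    intro t
    induction t with
    | zero =>
      simp only [cst, pow_zero]
      have : 0 ≤ (1 + ε) / (k:ℝ) := by positivity
      linarith
    | succ t ih =>
      simp only [cst]
      have h1 := mul_le_mul_of_nonneg_left ih hx0.le
      have h2 : ε / k + x * ((1 + ε) / k) ≤ (1 + ε) / k := by
        rw [← mul_div_assoc, ← add_div]
        apply div_le_div_of_nonneg_right _ hk'.le
        linarith
      rw [pow_succ]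
      rw [← hx]
      linarith
  obtain ⟨t, ht⟩ := exists_pow_lt_of_lt_one (show 0 < ε / k by positivity) hx1
  refine ⟨t, (h t).trans ?_⟩
  have : (1 + b) / k = (1 + ε) / k + ε / k := by rw [hε]; ring
  linarith

end PS

/-- Pippenger–Spencer: For every integer `k ≥ 2` and reals `r ≥ 1`,
`a > 0`, there are `γ > 0` and `d₀` such that for every `n` and every `D ≥ d₀`: every
`k`-uniform hypergraph `H` on `n` vertices in which every vertex has positive degree,
all but at most `γn` vertices `x` have degree `(1 ± γ)D`, every vertex has degree
`< rD`, and every pair of distinct vertices has codegree `< γD`, contains a cover of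
at most `(1 + a)(n/k)` edges. -/
theorem pippenger_spencer (k : ℕ) (hk : 2 ≤ k) (r a : ℝ) (hr : 1 ≤ r) (ha : 0 < a) :
    ∃ γ : ℝ, ∃ d₀ : ℝ, 0 < γ ∧
      ∀ (n : ℕ) (D : ℝ), d₀ ≤ D →
        ∀ H : Finset (Finset (Fin n)),
          (∀ e ∈ H, e.card = k) →
          (∀ x : Fin n, 0 < ((H.filter (fun e => x ∈ e)).card)) →
          ((({x : Fin n |
              ¬((1 - γ) * D ≤ ((H.filter (fun e => x ∈ e)).card : ℝ) ∧
                ((H.filter (fun e => x ∈ e)).card : ℝ) ≤ (1 + γ) * D)} :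
              Set (Fin n)).ncard : ℝ) ≤ γ * n) →
          (∀ x : Fin n, ((H.filter (fun e => x ∈ e)).card : ℝ) < r * D) →
          (∀ x y : Fin n, x ≠ y →
            ((H.filter (fun e => x ∈ e ∧ y ∈ e)).card : ℝ) < γ * D) →
          ∃ C ⊆ H, (∀ x : Fin n, ∃ e ∈ C, x ∈ e) ∧
            (C.card : ℝ) ≤ (1 + a) * ((n : ℝ) / (k : ℝ)) := by
  have hk' : (0:ℝ) < k := by exact_mod_cast (by omega : 0 < k)
  obtain ⟨ε, hε, t, ht⟩ := PS.cst_small k (by omega) (a / 2) (by positivity)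
  have hnib : ∃ δ : ℝ, 0 < δ ∧ ∀ n : ℕ, ∀ (V : Finset (Fin n)) (H : Finset (Finset (Fin n)))
      (D N : ℝ), 0 < D →
      (V.card : ℝ) ≤ N → (∀ e ∈ H, e.card = k) → (∀ e ∈ H, e ⊆ V) →
      (∀ x, PS.deg H x ≤ r * D) →
      (∀ x y, x ≠ y → PS.cod H x y ≤ δ * D) → PS.pot V H D ≤ δ ^ 2 * N * D ^ 2 →
      ∃ C ⊆ H, (C.card : ℝ) + (PS.surv V C).card ≤ PS.cst k ε t * V.card + a / (2 * k) * N := by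
    exact PS.nibble k (by omega) ε hε t r (a / (2 * k)) (by linarith) (by positivity)
  obtain ⟨δ, hδ, hnib⟩ := hnib
  have hr0 : 0 < 1 + r ^ 2 := by positivity
  set γ := min 1 (min δ (δ ^ 2 / (1 + r ^ 2))) with hγ
  have hγ0 : 0 < γ := by positivity
  have hγ1 : γ ≤ 1 := min_le_left _ _
  have hγ2 : γ ≤ δ := (min_le_right _ _).trans (min_le_left _ _)
  have hγ3 : γ * (1 + r ^ 2) ≤ δ ^ 2 := by
    rw [← le_div_iff₀ hr0]; exact (min_le_right _ _).trans (min_le_right _ _)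
  refine ⟨γ, 1, hγ0, ?_⟩
  intro n D hD H hU hpos hbad hdeg hcod
  have hD0 : 0 < D := by linarith
  have hpot : PS.pot Finset.univ H D ≤ δ ^ 2 * n * D ^ 2 := by
    classical
    set Bad : Finset (Fin n) := Finset.univ.filter (fun x =>
      ¬((1 - γ) * D ≤ PS.deg H x ∧ PS.deg H x ≤ (1 + γ) * D)) with hBad
    have hb : (Bad.card : ℝ) ≤ γ * n := by
      refine le_trans (le_of_eq ?_) hbad
      rw [← Set.ncard_coe_finset, hBad]
      congr 2
      ext x
      simp [PS.deg]
    have h1 : ∀ x : Fin n, (PS.deg H x - D) ^ 2 ≤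
        γ ^ 2 * D ^ 2 + (if x ∈ Bad then r ^ 2 * D ^ 2 else 0) := by
      intro x
      by_cases hx : x ∈ Bad
      · rw [if_pos hx]
        have h2 : PS.deg H x < r * D := hdeg x
        have h3 : 0 ≤ PS.deg H x := by unfold PS.deg; positivity
        have h4 : (PS.deg H x - D) ^ 2 ≤ (r * D) ^ 2 := by
          apply sq_le_sq'
          · nlinarith
          · linarith
        have h5 : 0 ≤ γ ^ 2 * D ^ 2 := by positivity
        nlinarith
      · rw [if_neg hx]
        have h2 : (1 - γ) * D ≤ PS.deg H x ∧ PS.deg H x ≤ (1 + γ) * D := by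
          by_contra hcon
          exact hx (Finset.mem_filter.2 ⟨Finset.mem_univ _, hcon⟩)
        rw [add_zero, ← mul_pow]
        apply sq_le_sq' <;> linarith [h2.1, h2.2]
    calc PS.pot Finset.univ H D ≤ ∑ x : Fin n,
          (γ ^ 2 * D ^ 2 + (if x ∈ Bad then r ^ 2 * D ^ 2 else 0)) :=
          Finset.sum_le_sum fun x _ => h1 x
      _ = n * (γ ^ 2 * D ^ 2) + Bad.card * (r ^ 2 * D ^ 2) := by
          rw [Finset.sum_add_distrib, ← Finset.sum_filter, Finset.sum_const, Finset.sum_const,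
            nsmul_eq_mul, nsmul_eq_mul]
          simp
      _ ≤ n * (γ * D ^ 2) + (γ * n) * (r ^ 2 * D ^ 2) := by
          gcongr
          nlinarith
      _ = (γ * (1 + r ^ 2)) * n * D ^ 2 := by ring
      _ ≤ _ := by gcongr
  obtain ⟨C, hC, hCc⟩ := hnib n Finset.univ H D n hD0 (by simp) hU
    (fun e _ => Finset.subset_univ e) (fun x => (hdeg x).le)
    (fun x y hxy => (hcod x y hxy).le.trans (by gcongr)) hpot
  have hex : ∀ x : Fin n, ∃ e ∈ H, x ∈ e := by
    intro x
    obtain ⟨e, he⟩ := Finset.card_pos.1 (hpos x)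
    exact ⟨e, (Finset.mem_filter.1 he).1, (Finset.mem_filter.1 he).2⟩
  choose φ hφ1 hφ2 using hex
  refine ⟨C ∪ (PS.surv Finset.univ C).image φ, ?_, ?_, ?_⟩
  · apply Finset.union_subset hC
    intro e he
    obtain ⟨x, _, rfl⟩ := Finset.mem_image.1 he
    exact hφ1 x
  · intro x
    by_cases hx : x ∈ PS.surv Finset.univ C
    · exact ⟨φ x, Finset.mem_union_right _ (Finset.mem_image_of_mem φ hx), hφ2 x⟩
    · simp only [PS.surv, Finset.mem_filter, Finset.mem_univ, true_and, not_forall, not_not] at hx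
      obtain ⟨e, he, hxe⟩ := hx
      exact ⟨e, Finset.mem_union_left _ he, hxe⟩
  · have h1 : ((C ∪ (PS.surv Finset.univ C).image φ).card : ℝ) ≤
        C.card + (PS.surv Finset.univ C).card := by
      exact_mod_cast (Finset.card_union_le _ _).trans
        (Nat.add_le_add_left Finset.card_image_le _)
    have h2 : PS.cst k ε t * n ≤ (1 + a / 2) / k * n := by gcongr
    simp only [Finset.card_univ, Fintype.card_fin] at hCc
    have h3 : (1 + a) * ((n:ℝ) / k) = (1 + a / 2) / k * n + a / (2 * k) * n := by
      field_simp; ring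
    linarith
end
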